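/- arXiv:1304.5444 — 6 statements merged into one kernel-verified Lean document; each statement's English description precedes it below -/
import Mathlib

section
/- Let H be a non-abelian finite simple group. Suppose there is a set of t ≥ 1 pairs (T_{1,s}, T_{2,s}), s = 1, ..., t, of generating triples for H such that: (1) for each prime p dividing |H| there is some s such that T_{1,s} and T_{2,s} are a strongly p-distinguishing pair; and (2) for each i = 1, 2, the 3t triples consisting of T_{i,1}, ..., T_{i,t} and all their cyclic permutations are mutually inequivalent. Then H^k is a Beauville group for every k with 3t ≤ k ≤ d₂(H). -/
/-- The set of elements of `G` conjugate to a power of `a`, `b` or `c`. -/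
def SigmaSet {G : Type*} [Group G] (a b c : G) : Set G :=
  {g | ∃ d ∈ ({a, b, c} : Set G), ∃ m : ℤ, IsConj (d ^ m) g}

/-- `G` is an (unmixed) Beauville group. -/
def IsBeauvilleGroup (G : Type*) [Group G] : Prop :=
  ∃ a₁ b₁ c₁ a₂ b₂ c₂ : G,
    (Subgroup.closure {a₁, b₁, c₁} = ⊤ ∧ a₁ * b₁ * c₁ = 1 ∧
      (1 : ℚ) / (orderOf a₁) + 1 / (orderOf b₁) + 1 / (orderOf c₁) < 1) ∧
    (Subgroup.closure {a₂, b₂, c₂} = ⊤ ∧ a₂ * b₂ * c₂ = 1 ∧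
      (1 : ℚ) / (orderOf a₂) + 1 / (orderOf b₂) + 1 / (orderOf c₂) < 1) ∧
    SigmaSet a₁ b₁ c₁ ∩ SigmaSet a₂ b₂ c₂ = {1}

/-- `d₂ H`: the number of orbits of `Aut H` on ordered generating pairs of `H`. -/
noncomputable def d2 (H : Type*) [Group H] : ℕ :=
  Nat.card (Quot (fun p q : {p : H × H // Subgroup.closure {p.1, p.2} = ⊤} =>
    ∃ φ : MulAut H, φ p.val.1 = q.val.1 ∧ φ p.val.2 = q.val.2))

/-- `(x, y, z)` is a generating triple for `H`: `x * y * z = 1` and `{x, y, z}` generates. -/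
def IsGenTriple {H : Type*} [Group H] (T : H × H × H) : Prop :=
  T.1 * T.2.1 * T.2.2 = 1 ∧ Subgroup.closure ({T.1, T.2.1, T.2.2} : Set H) = ⊤

/-- Two triples are equivalent if an automorphism of `H` takes one to the other. -/
def EquivTriple {H : Type*} [Group H] (T T' : H × H × H) : Prop :=
  ∃ φ : MulAut H, φ T.1 = T'.1 ∧ φ T.2.1 = T'.2.1 ∧ φ T.2.2 = T'.2.2

/-- Cyclic permutation of a triple. -/
def cycPerm {H : Type*} (T : H × H × H) : H × H × H := (T.2.1, T.2.2, T.1)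

/-- `h` is `p`-full: the highest power of `p` dividing the exponent of `H`
divides the order of `h`. -/
def pFull {H : Type*} [Group H] (p : ℕ) (h : H) : Prop :=
  p ^ ((Monoid.exponent H).factorization p) ∣ orderOf h

open Classical in
/-- `ν_p(T)`: the number of `p`-full entries of the triple `T`. -/
noncomputable def nuP {H : Type*} [Group H] (p : ℕ) (T : H × H × H) : ℕ :=
  (if pFull p T.1 then 1 else 0) + (if pFull p T.2.1 then 1 else 0) +
    (if pFull p T.2.2 then 1 else 0)

/-- `T₁, T₂` are `p`-distinguishing if `ν_p(T₁) ≠ ν_p(T₂)`. -/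
def PDistinguishing {H : Type*} [Group H] (p : ℕ) (T₁ T₂ : H × H × H) : Prop :=
  nuP p T₁ ≠ nuP p T₂

/-- `T₁, T₂` are strongly `p`-distinguishing. -/
def StronglyPDistinguishing {H : Type*} [Group H] (p : ℕ) (T₁ T₂ : H × H × H) : Prop :=
  PDistinguishing p T₁ T₂ ∧
  ∀ T ∈ ({T₁, T₂} : Set (H × H × H)), nuP p T = 0 →
    (¬ p ^ 2 ∣ Monoid.exponent H ∨
      (¬ p ∣ orderOf T.1 ∧ ¬ p ∣ orderOf T.2.1 ∧ ¬ p ∣ orderOf T.2.2))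

section SimpleGroups

variable {H : Type*} [Group H]

theorem conj_mem_of_closure_pair_eq_top [Finite H] {x y : H} {S : Set H}
    (hxy : Subgroup.closure {x, y} = ⊤) (hx : ∀ s ∈ S, x * s * x⁻¹ ∈ S)
    (hy : ∀ s ∈ S, y * s * y⁻¹ ∈ S) (g : H) : ∀ s ∈ S, g * s * g⁻¹ ∈ S := by
  have hg : g ∈ Submonoid.closure ({x, y} : Set H) := by
    rw [← Subgroup.closure_toSubmonoid_of_finite, hxy]
    trivial
  induction hg using Submonoid.closure_induction with
  | mem z hz =>
    rcases hz with rfl | rfl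
    · exact hx
    · exact hy
  | one => simp
  | mul a b _ _ ha hb =>
    intro s hs
    simpa [mul_assoc] using ha _ (hb s hs)

theorem commute_of_closure_eq_top {S : Set H} (hS : Subgroup.closure S = ⊤)
    (hc : ∀ u ∈ S, ∀ v ∈ S, u * v = v * u) (a b : H) : a * b = b * a := by
  have ha : a ∈ Subgroup.closure S := hS ▸ Subgroup.mem_top a
  have hb : b ∈ Subgroup.closure S := hS ▸ Subgroup.mem_top b
  induction ha, hb using Subgroup.closure_induction₂ with
  | mem x y hx hy => exact hc x hx y hy
  | one_left => simp
  | one_right => simp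
  | mul_left x y z _ _ _ h₁ h₂ => exact (Commute.mul_left h₁ h₂ :)
  | mul_right x y z _ _ _ h₁ h₂ => exact (Commute.mul_right h₁ h₂ :)
  | inv_left x y _ _ h => exact (Commute.inv_left h :)
  | inv_right x y _ _ h => exact (Commute.inv_right h :)

theorem commute_of_closure_pair_eq_top {x y : H} (hxy : Subgroup.closure {x, y} = ⊤)
    (h : x * y = y * x) (a b : H) : a * b = b * a := by
  refine commute_of_closure_eq_top hxy ?_ a b
  rintro u (rfl | rfl) v (rfl | rfl)
  · rfl
  · exact h
  · exact h.symm
  · rfl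

/-- A simple group generated by `x` and `y` with `x ^ 3 = y ^ 3 = (x * y) ^ 3 = 1` is abelian,
because the normal closure of `x * y⁻¹` is. -/
theorem commute_of_pow_three_eq_one [Finite H] [IsSimpleGroup H] {x y : H}
    (hxy : Subgroup.closure {x, y} = ⊤) (hx : x ^ 3 = 1) (hy : y ^ 3 = 1)
    (h : (x * y) ^ 3 = 1) (a b : H) : a * b = b * a := by
  set u := x * y⁻¹ with hu
  set v := x⁻¹ * u * x with hv
  set w := x⁻¹ * v * x with hw
  have hx2 : x * x = x⁻¹ := by
    rw [eq_inv_iff_mul_eq_one, ← hx, pow_succ, pow_two]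
  have hy2 : y⁻¹ * y⁻¹ = y := by
    rw [← mul_inv_rev, inv_eq_iff_mul_eq_one, ← hy, pow_succ, pow_two]
  have hxyx : x * y * x = y⁻¹ * x⁻¹ * y⁻¹ := by
    rw [← mul_inv_rev, ← mul_inv_rev, eq_inv_iff_mul_eq_one, ← h, pow_succ, pow_two]
    group
  have huv : Commute u v := by
    have h₁ : u * v = x * y * x := by
      rw [hv, hu]
      calc x * y⁻¹ * (x⁻¹ * (x * y⁻¹) * x) = x * (y⁻¹ * y⁻¹) * x := by group
        _ = _ := by rw [hy2]
    have h₂ : v * u = y⁻¹ * x⁻¹ * y⁻¹ := by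
      rw [hv, hu]
      calc x⁻¹ * (x * y⁻¹) * x * (x * y⁻¹) = y⁻¹ * (x * x) * y⁻¹ := by group
        _ = _ := by rw [hx2]
    exact h₁.trans (hxyx.trans h₂.symm)
  have conj_comm : ∀ {s r : H}, Commute s r → Commute (x⁻¹ * s * x) (x⁻¹ * r * x) := by
    intro s r hsr
    have := hsr.map (MulAut.conj x⁻¹).toMonoidHom
    simpa using this
  have hvw : Commute v w := conj_comm huv
  have hwu : Commute w u := by
    have hwx : x⁻¹ * w * x = u := by
      rw [hw, hv]
      calc x⁻¹ * (x⁻¹ * (x⁻¹ * u * x) * x) * x = (x ^ 3)⁻¹ * u * x ^ 3 := by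
            rw [pow_succ, pow_two]
            group
        _ = u := by simp [hx]
    have := conj_comm hvw
    rwa [hwx] at this
  have cu : x * u * x⁻¹ = w := by
    rw [hw, hv]
    calc x * u * x⁻¹ = x ^ 3 * (x⁻¹ * (x⁻¹ * u * x) * x) * (x ^ 3)⁻¹ := by
          rw [pow_succ, pow_two]
          group
      _ = _ := by simp [hx]
  have cv : x * v * x⁻¹ = u := by rw [hv]; group
  have cw : x * w * x⁻¹ = v := by rw [hw]; group
  set S : Set H := {u, v, w} with hS
  have hSS : ∀ s ∈ S, ∀ r ∈ S, s * r = r * s := by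
    rintro s (rfl | rfl | rfl) r (rfl | rfl | rfl)
    · rfl
    · exact huv
    · exact hwu.symm
    · exact huv.symm
    · rfl
    · exact hvw
    · exact hwu
    · exact hvw.symm
    · rfl
  have hSx : ∀ s ∈ S, x * s * x⁻¹ ∈ S := by
    rintro s (rfl | rfl | rfl)
    · rw [cu]; simp [hS]
    · rw [cv]; simp [hS]
    · rw [cw]; simp [hS]
  have hSy : ∀ s ∈ S, y * s * y⁻¹ ∈ S := by
    intro s hs
    have key : y * s * y⁻¹ = x * s * x⁻¹ := by
      have hc := hSS u (by simp [hS]) _ (hSx s hs)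
      have hyu : y = u⁻¹ * x := by rw [hu]; group
      calc y * s * y⁻¹ = u⁻¹ * (x * s * x⁻¹) * u := by rw [hyu]; group
        _ = u⁻¹ * (u * (x * s * x⁻¹)) := by rw [mul_assoc, hc]
        _ = _ := by group
    rw [key]
    exact hSx s hs
  have hconj := conj_mem_of_closure_pair_eq_top hxy hSx hSy
  have hle : Subgroup.normalClosure {u} ≤ Subgroup.closure S := by
    rw [Subgroup.normalClosure]
    refine Subgroup.closure_mono ?_
    intro g hg
    obtain ⟨s, hs, hsg⟩ := Group.mem_conjugatesOfSet_iff.1 hg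
    obtain ⟨c, rfl⟩ := isConj_iff.1 hsg
    rw [Set.mem_singleton_iff.1 hs]
    exact hconj c u (by simp [hS])
  rcases (Subgroup.normalClosure_normal (s := {u})).eq_bot_or_eq_top with hN | hN
  · have hu1 : u = 1 := by
      have : u ∈ Subgroup.normalClosure {u} := Subgroup.subset_normalClosure rfl
      rwa [hN, Subgroup.mem_bot] at this
    have : x = y := by rwa [hu, mul_inv_eq_one] at hu1
    exact commute_of_closure_pair_eq_top hxy (by rw [this]) a b
  · exact commute_of_closure_eq_top (top_le_iff.1 (hN ▸ hle)) hSS a b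

open scoped commutatorElement in
theorem commutator_eq_top_of_not_commute [IsSimpleGroup H]
    (hnonab : ∃ a b : H, a * b ≠ b * a) : commutator H = ⊤ := by
  rcases (inferInstance : (commutator H).Normal).eq_bot_or_eq_top with h | h
  · obtain ⟨a, b, hab⟩ := hnonab
    refine absurd ?_ hab
    have : ⁅a, b⁆ ∈ commutator H :=
      Subgroup.commutator_mem_commutator (Subgroup.mem_top a) (Subgroup.mem_top b)
    rw [h, Subgroup.mem_bot] at this
    exact commutatorElement_eq_one_iff_mul_comm.1 this
  · exact h

/-- Two epimorphisms onto a finite simple group either differ by an automorphism, or the kernel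
of the second is mapped onto the group by the first. -/
theorem exists_mulAut_or_forall_exists_ker [Finite H] [IsSimpleGroup H] {G : Type*} [Group G]
    (f g : G →* H) (hf : Function.Surjective f) (hg : Function.Surjective g) :
    (∃ φ : MulAut H, ∀ x, φ (g x) = f x) ∨ ∀ h, ∃ x, f x = h ∧ g x = 1 := by
  have hn : (g.ker.map f).Normal := Subgroup.Normal.map inferInstance f hf
  rcases hn.eq_bot_or_eq_top with hN | hN
  · left
    have hle : g.ker ≤ f.ker := (Subgroup.map_eq_bot_iff _).1 hN
    set ψ := g.liftOfRightInverse _ (Function.rightInverse_surjInv hg) ⟨f, hle⟩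
    have hψ : ∀ x, ψ (g x) = f x :=
      g.liftOfRightInverse_comp_apply _ (Function.rightInverse_surjInv hg) ⟨f, hle⟩
    have hs : Function.Surjective ψ := fun h => by
      obtain ⟨x, rfl⟩ := hf h
      exact ⟨g x, hψ x⟩
    exact ⟨MulEquiv.ofBijective ψ (Finite.surjective_iff_bijective.1 hs), hψ⟩
  · right
    intro h
    obtain ⟨x, hx, rfl⟩ := (hN ▸ Subgroup.mem_top h : h ∈ g.ker.map f)
    exact ⟨x, rfl, hx⟩

open scoped commutatorElement in
theorem exists_mem_eq_and_forall_eq_one {ι : Type*} (hperf : commutator H = ⊤)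
    (K : Subgroup (ι → H)) (hsurj : ∀ i h, ∃ g ∈ K, g i = h)
    (hpair : ∀ i j, i ≠ j → ∀ h, ∃ g ∈ K, g i = h ∧ g j = 1) (i : ι) (S : Finset ι) (hi : i ∉ S)
    (h : H) : ∃ g ∈ K, g i = h ∧ ∀ j ∈ S, g j = 1 := by
  classical
  induction S using Finset.induction_on generalizing h with
  | empty => simpa using hsurj i h
  | insert j S _ ih =>
    rw [Finset.mem_insert, not_or] at hi
    have hh : h ∈ commutator H := hperf ▸ Subgroup.mem_top h
    rw [commutator_eq_closure] at hh
    induction hh using Subgroup.closure_induction with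
    | mem c hc =>
      obtain ⟨a, b, rfl⟩ := hc
      obtain ⟨g, hgK, rfl, hgS⟩ := ih hi.2 a
      obtain ⟨g', hgK', rfl, hgj⟩ := hpair i j hi.1 b
      refine ⟨⁅g, g'⁆, ?_, rfl, ?_⟩
      · exact K.mul_mem (K.mul_mem (K.mul_mem hgK hgK') (K.inv_mem hgK)) (K.inv_mem hgK')
      · intro l hl
        rcases Finset.mem_insert.1 hl with rfl | hl
        · simp [commutatorElement_def, hgj]
        · simp [commutatorElement_def, hgS l hl]
    | one => exact ⟨1, K.one_mem, rfl, fun _ _ => rfl⟩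
    | mul a b _ _ ha hb =>
      obtain ⟨g, hgK, rfl, hg⟩ := ha
      obtain ⟨g', hgK', rfl, hg'⟩ := hb
      exact ⟨g * g', K.mul_mem hgK hgK', rfl, fun l hl => by simp [hg l hl, hg' l hl]⟩
    | inv a _ ha =>
      obtain ⟨g, hgK, rfl, hg⟩ := ha
      exact ⟨g⁻¹, K.inv_mem hgK, rfl, fun l hl => by simp [hg l hl]⟩

theorem subgroup_pi_eq_top_of_forall_pair {ι : Type*} [Finite ι] (hperf : commutator H = ⊤)
    (K : Subgroup (ι → H)) (hsurj : ∀ i h, ∃ g ∈ K, g i = h)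
    (hpair : ∀ i j, i ≠ j → ∀ h, ∃ g ∈ K, g i = h ∧ g j = 1) : K = ⊤ := by
  classical
  cases nonempty_fintype ι
  refine eq_top_iff.2 fun x _ => Subgroup.pi_mem_of_mulSingle_mem x fun i => ?_
  obtain ⟨g, hgK, hgi, hg⟩ := exists_mem_eq_and_forall_eq_one hperf K hsurj hpair i
    (Finset.univ.erase i) (by simp) (x i)
  convert hgK using 1
  ext j
  rcases eq_or_ne j i with rfl | hj
  · simp [hgi]
  · simp [Pi.mulSingle_eq_of_ne hj, hg j (by simpa using hj)]

end SimpleGroups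

section Triples

variable {H : Type*} [Group H]

theorem IsGenTriple.closure_pair {T : H × H × H} (hT : IsGenTriple T) :
    Subgroup.closure {T.1, T.2.1} = ⊤ := by
  rw [← top_le_iff, ← hT.2, Subgroup.closure_le]
  have h₁ : T.1 ∈ Subgroup.closure {T.1, T.2.1} := Subgroup.subset_closure (by simp)
  have h₂ : T.2.1 ∈ Subgroup.closure {T.1, T.2.1} := Subgroup.subset_closure (by simp)
  rintro g (rfl | rfl | rfl)
  · exact h₁
  · exact h₂
  · rw [← inv_eq_of_mul_eq_one_right hT.1]
    exact inv_mem (mul_mem h₁ h₂)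

theorem IsGenTriple.cycPerm {T : H × H × H} (hT : IsGenTriple T) : IsGenTriple (cycPerm T) := by
  obtain ⟨x, y, z⟩ := T
  obtain ⟨h₁, h₂⟩ := hT
  constructor
  · have : z = (x * y)⁻¹ := (inv_eq_of_mul_eq_one_right h₁).symm
    simp only [_root_.cycPerm, this]
    group
  · rw [← h₂]
    congr 1
    ext g
    simp only [_root_.cycPerm, Set.mem_insert_iff, Set.mem_singleton_iff]
    tauto

theorem IsGenTriple.iterate_cycPerm {T : H × H × H} (hT : IsGenTriple T) (m : ℕ) :
    IsGenTriple (_root_.cycPerm^[m] T) := by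
  induction m with
  | zero => exact hT
  | succ m ih =>
    rw [Function.iterate_succ_apply']
    exact ih.cycPerm

theorem EquivTriple.of_pair {T T' : H × H × H} (hT : IsGenTriple T) (hT' : IsGenTriple T')
    (φ : MulAut H) (h₁ : φ T.1 = T'.1) (h₂ : φ T.2.1 = T'.2.1) : EquivTriple T T' := by
  refine ⟨φ, h₁, h₂, ?_⟩
  rw [← inv_eq_of_mul_eq_one_right hT.1, ← inv_eq_of_mul_eq_one_right hT'.1, map_inv, map_mul,
    h₁, h₂]

theorem EquivTriple.symm {T T' : H × H × H} (h : EquivTriple T T') : EquivTriple T' T := by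
  obtain ⟨φ, h₁, h₂, h₃⟩ := h
  exact ⟨φ⁻¹, by simp [← h₁], by simp [← h₂], by simp [← h₃]⟩

/-- The common exponent of the entries of a generating triple of a nonabelian finite simple group
is at least `4`. -/
theorem IsGenTriple.four_le [Finite H] [IsSimpleGroup H] (hnonab : ∃ a b : H, a * b ≠ b * a)
    {T : H × H × H} (hT : IsGenTriple T) {n : ℕ} (hn : n ≠ 0) (h₁ : T.1 ^ n = 1)
    (h₂ : T.2.1 ^ n = 1) (h₃ : T.2.2 ^ n = 1) : 4 ≤ n := by
  obtain ⟨a, b, hab⟩ := hnonab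
  have hxy := hT.closure_pair
  have hz : (T.1 * T.2.1) ^ n = 1 := by
    rw [← inv_eq_one, ← inv_pow, inv_eq_of_mul_eq_one_right hT.1, h₃]
  by_contra! hlt
  refine hab ?_
  interval_cases n
  · exact absurd rfl hn
  · rw [pow_one] at h₁ h₂
    exact commute_of_closure_pair_eq_top hxy (by rw [h₁, h₂]) a b
  · refine commute_of_closure_pair_eq_top hxy ?_ a b
    rw [pow_two, ← eq_inv_iff_mul_eq_one] at h₁ h₂ hz
    rw [hz, mul_inv_rev, ← h₁, ← h₂]
  · exact commute_of_pow_three_eq_one hxy h₁ h₂ hz a b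

theorem IsGenTriple.pi {ι : Type*} [Finite ι] [Finite H] [IsSimpleGroup H]
    (hnonab : ∃ a b : H, a * b ≠ b * a) (P : ι → H × H × H) (hP : ∀ j, IsGenTriple (P j))
    (hne : ∀ i j, i ≠ j → ¬ EquivTriple (P i) (P j)) :
    IsGenTriple (H := ι → H) (fun j => (P j).1, fun j => (P j).2.1, fun j => (P j).2.2) := by
  refine ⟨funext fun j => (hP j).1, ?_⟩
  set a : ι → H := fun j => (P j).1 with ha
  set b : ι → H := fun j => (P j).2.1 with hb
  set c : ι → H := fun j => (P j).2.2 with hc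
  set K := Subgroup.closure ({a, b, c} : Set (ι → H)) with hK
  have haK : a ∈ K := Subgroup.subset_closure (by simp)
  have hbK : b ∈ K := Subgroup.subset_closure (by simp)
  let f : ι → K →* H := fun i => (Pi.evalMonoidHom (fun _ => H) i).comp K.subtype
  have hf : ∀ i, Function.Surjective (f i) := fun i => by
    rw [← MonoidHom.range_eq_top, ← top_le_iff, ← (hP i).closure_pair, Subgroup.closure_le]
    rintro g (rfl | rfl)
    · exact ⟨⟨a, haK⟩, rfl⟩
    · exact ⟨⟨b, hbK⟩, rfl⟩
  refine subgroup_pi_eq_top_of_forall_pair (commutator_eq_top_of_not_commute hnonab) K ?_ ?_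
  · intro i h
    obtain ⟨g, hg⟩ := hf i h
    exact ⟨g, g.2, hg⟩
  · intro i j hij h
    rcases exists_mulAut_or_forall_exists_ker (f i) (f j) (hf i) (hf j) with ⟨φ, hφ⟩ | hker
    · exact absurd (EquivTriple.of_pair (hP j) (hP i) φ (hφ ⟨a, haK⟩) (hφ ⟨b, hbK⟩))
        (hne j i hij.symm)
    · obtain ⟨g, hg, hg'⟩ := hker h
      exact ⟨g, g.2, hg, hg'⟩

/-- A family of inequivalent generating triples indexed by part of a type with at most `d2 H`
elements extends, up to equivalence, to the whole type. -/
theorem exists_inequivalent_extension [Finite H] {α ι : Type*} [Finite α] [Finite ι]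
    (F : α → H × H × H) (hF : ∀ r, IsGenTriple (F r))
    (hne : ∀ r r', r ≠ r' → ¬ EquivTriple (F r) (F r')) (e : α ↪ ι) (hι : Nat.card ι ≤ d2 H) :
    ∃ P : ι → H × H × H, (∀ j, IsGenTriple (P j)) ∧
      (∀ i j, i ≠ j → ¬ EquivTriple (P i) (P j)) ∧ ∀ r, EquivTriple (P (e r)) (F r) := by
  classical
  let R : {p : H × H // Subgroup.closure {p.1, p.2} = ⊤} →
      {p : H × H // Subgroup.closure {p.1, p.2} = ⊤} → Prop :=
    fun p q => ∃ φ : MulAut H, φ p.val.1 = q.val.1 ∧ φ p.val.2 = q.val.2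
  have hR : Equivalence R := by
    refine ⟨fun p => ⟨1, rfl, rfl⟩, ?_, ?_⟩
    · rintro p q ⟨φ, h₁, h₂⟩
      exact ⟨φ⁻¹, by simp [← h₁], by simp [← h₂]⟩
    · rintro p q r ⟨φ, h₁, h₂⟩ ⟨ψ, h₃, h₄⟩
      exact ⟨ψ * φ, by simp [h₁, h₃], by simp [h₂, h₄]⟩
  have hQ : ∀ p q, Quot.mk R p = Quot.mk R q ↔ R p q := fun p q =>
    ⟨fun h => hR.eqvGen_iff.1 (Quot.eqvGen_exact h), Quot.sound⟩
  cases nonempty_fintype α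
  cases nonempty_fintype ι
  have : Fintype (Quot R) := Fintype.ofFinite _
  rw [show d2 H = Nat.card (Quot R) from rfl, Nat.card_eq_fintype_card,
    Nat.card_eq_fintype_card] at hι
  let mk : α → Quot R := fun r => Quot.mk R ⟨((F r).1, (F r).2.1), (hF r).closure_pair⟩
  have hmk : Function.Injective mk := fun r r' h => by
    by_contra hrr
    obtain ⟨φ, h₁, h₂⟩ := (hQ _ _).1 h
    exact hne r r' hrr (EquivTriple.of_pair (hF r) (hF r') φ h₁ h₂)
  obtain ⟨S, hS, -, hScard⟩ := Finset.exists_subsuperset_card_eq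
    (Finset.subset_univ (Finset.univ.image mk)) (n := Fintype.card ι)
    (by
      rw [Finset.card_image_of_injective _ hmk]
      exact Fintype.card_le_of_embedding e) hι
  obtain ⟨E, hE⟩ : ∃ E : ι → Quot R, Function.Injective E ∧ ∀ r, E (e r) = mk r := by
    rcases isEmpty_or_nonempty α with hα | ⟨⟨r₀⟩⟩
    · exact ⟨fun j => (Fintype.equivOfCardEq (β := S) (by simp [hScard]) j : S),
        Subtype.val_injective.comp (Equiv.injective _), hα.elim⟩
    · let f : ι → Quot R := Function.extend e mk fun _ => mk r₀
      have hfe : ∀ r, f (e r) = mk r := fun r => e.injective.extend_apply _ _ r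
      obtain ⟨E, hE⟩ := Finset.exists_equiv_extend_of_card_eq hScard.symm
        (s := Finset.univ.image e) (f := f)
        (by
          intro q hq
          refine hS ?_
          simp only [Finset.mem_image, Finset.mem_univ, true_and] at hq ⊢
          obtain ⟨_, ⟨r, rfl⟩, rfl⟩ := hq
          exact ⟨r, (hfe r).symm⟩)
        (by
          intro i hi j hj hij
          simp only [Finset.coe_image, Finset.coe_univ, Set.image_univ, Set.mem_range] at hi hj
          obtain ⟨r, rfl⟩ := hi
          obtain ⟨r', rfl⟩ := hj
          rw [hfe, hfe] at hij
          rw [hmk hij])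
      exact ⟨fun j => E j, Subtype.val_injective.comp E.injective, fun r =>
        (hE _ (by simp)).trans (hfe r)⟩
  obtain ⟨hEinj, hEe⟩ := hE
  let out : ι → {p : H × H // Subgroup.closure {p.1, p.2} = ⊤} := fun j => (E j).out
  have hout : ∀ j, Quot.mk R (out j) = E j := fun j => Quot.out_eq _
  let P : ι → H × H × H := fun j => ((out j).1.1, (out j).1.2, ((out j).1.1 * (out j).1.2)⁻¹)
  have hP : ∀ j, IsGenTriple (P j) := fun j => by
    refine ⟨mul_inv_cancel _, ?_⟩
    rw [← top_le_iff, ← (out j).2]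
    refine Subgroup.closure_mono ?_
    rintro g (rfl | rfl) <;> simp [P]
  refine ⟨P, hP, ?_, ?_⟩
  · rintro i j hij ⟨φ, h₁, h₂, -⟩
    refine hij (hEinj ?_)
    rw [← hout, ← hout]
    exact (hQ _ _).2 ⟨φ, h₁, h₂⟩
  · intro r
    obtain ⟨φ, h₁, h₂⟩ := (hQ _ _).1 ((hout (e r)).trans (hEe r))
    exact EquivTriple.of_pair (hP _) (hF r) φ h₁ h₂

end Triples

section Orders

/-- If `n` divides `m * p`, then only the `p`-part of `n` matters for whether `n ∣ m`. -/
theorem Nat.dvd_of_dvd_mul_prime {p n m : ℕ} (hp : p.Prime) (hn : n ≠ 0) (h : n ∣ m * p)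
    (hpm : p ^ n.factorization p ∣ m) : n ∣ m := by
  have hc : (n / p ^ n.factorization p).Coprime p := (Nat.coprime_ordCompl hp hn).symm
  have h₂ : n / p ^ n.factorization p ∣ m :=
    hc.dvd_of_dvd_mul_right ((Nat.ordCompl_dvd n p).trans h)
  rw [← Nat.ordProj_mul_ordCompl_eq_self n p]
  exact Nat.Coprime.mul_dvd_of_dvd_of_dvd (hc.symm.pow_left _) hpm h₂

variable {H : Type*} [Group H]

theorem pFull_iff_le [Finite H] {p : ℕ} (hp : p.Prime) {h : H} :
    pFull p h ↔ (Monoid.exponent H).factorization p ≤ (orderOf h).factorization p :=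
  hp.pow_dvd_iff_le_factorization (orderOf_pos h).ne'

theorem orderOf_factorization_le [Finite H] (p : ℕ) (h : H) :
    (orderOf h).factorization p ≤ (Monoid.exponent H).factorization p :=
  (Nat.factorization_le_iff_dvd (orderOf_pos h).ne' Monoid.exponent_ne_zero_of_finite).2
    (Monoid.order_dvd_exponent h) p

/-- If a power of `d` has prime order `p` and `d` has a `p`-full coordinate, then the nontrivial
coordinates of that power are the `p`-full coordinates of `d`. -/
theorem pow_apply_eq_one_iff_not_pFull [Finite H] {ι : Type*} {p : ℕ} (hp : p.Prime)
    {d : ι → H} {m : ℕ} (hd : (d ^ m) ^ p = 1) (hne : d ^ m ≠ 1) {i : ι} (hi : pFull p (d i))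
    (j : ι) : (d ^ m) j = 1 ↔ ¬ pFull p (d j) := by
  have hdvd : ∀ l, orderOf (d l) ∣ m * p := fun l => by
    rw [orderOf_dvd_iff_pow_eq_one, pow_mul]
    exact congrFun hd l
  have key : ∀ l, p ^ (orderOf (d l)).factorization p ∣ m → (d ^ m) l = 1 := fun l hl =>
    orderOf_dvd_iff_pow_eq_one.1
      (Nat.dvd_of_dvd_mul_prime hp (orderOf_pos _).ne' (hdvd l) hl)
  set n := (Monoid.exponent H).factorization p with hn
  constructor
  · intro h hj
    refine hne (funext fun l => key l ?_)
    exact (pow_dvd_pow p (orderOf_factorization_le p (d l))).trans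
      (hj.trans (orderOf_dvd_of_pow_eq_one h))
  · intro hj
    rw [pFull_iff_le hp, not_le] at hj
    refine key j ((pow_dvd_pow p (Nat.le_sub_one_of_lt hj)).trans ?_)
    have h₁ : p ^ n ∣ m * p := hi.trans (hdvd i)
    have hn0 : n = n - 1 + 1 := by omega
    rw [hn0, pow_succ] at h₁
    exact Nat.dvd_of_mul_dvd_mul_right hp.pos h₁

theorem pow_apply_eq_one_of_not_dvd {ι : Type*} {p : ℕ} (hp : p.Prime) {d : ι → H} {m : ℕ}
    (hd : (d ^ m) ^ p = 1) {j : ι} (hj : ¬ p ∣ orderOf (d j)) : (d ^ m) j = 1 := by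
  refine orderOf_dvd_iff_pow_eq_one.1 (Nat.Coprime.dvd_of_dvd_mul_right
    (hp.coprime_iff_not_dvd.2 hj).symm (orderOf_dvd_iff_pow_eq_one.2 ?_))
  rw [pow_mul]
  exact congrFun hd j

theorem pFull_congr {p : ℕ} {h h' : H} (hh : orderOf h = orderOf h') :
    pFull p h ↔ pFull p h' := by
  rw [pFull, pFull, hh]

theorem pFull_iff_dvd [Finite H] {p : ℕ} (hp : p.Prime) (hpe : p ∣ Monoid.exponent H)
    (hpe2 : ¬ p ^ 2 ∣ Monoid.exponent H) {h : H} : pFull p h ↔ p ∣ orderOf h := by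
  have h0 : Monoid.exponent H ≠ 0 := Monoid.exponent_ne_zero_of_finite
  rw [hp.pow_dvd_iff_le_factorization h0] at hpe2
  have := (hp.dvd_iff_one_le_factorization h0).1 hpe
  rw [pFull, show (Monoid.exponent H).factorization p = 1 by omega, pow_one]

/-- The orders of the entries of `d` are those of `T`, up to cyclic rotation. -/
def OrdersMatch (T : H × H × H) (d : Fin 3 → H) : Prop :=
  (orderOf (d 0) = orderOf T.1 ∧ orderOf (d 1) = orderOf T.2.1 ∧
      orderOf (d 2) = orderOf T.2.2) ∨
    (orderOf (d 0) = orderOf T.2.1 ∧ orderOf (d 1) = orderOf T.2.2 ∧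
      orderOf (d 2) = orderOf T.1) ∨
    (orderOf (d 0) = orderOf T.2.2 ∧ orderOf (d 1) = orderOf T.1 ∧
      orderOf (d 2) = orderOf T.2.1)

open Classical in
theorem OrdersMatch.card_pFull {T : H × H × H} {d : Fin 3 → H} (h : OrdersMatch T d) (p : ℕ) :
    (Finset.univ.filter fun m => pFull p (d m)).card = nuP p T := by
  rw [Finset.card_filter, Fin.sum_univ_three, nuP]
  rcases h with ⟨h₀, h₁, h₂⟩ | ⟨h₀, h₁, h₂⟩ | ⟨h₀, h₁, h₂⟩ <;>
    simp only [pFull_congr h₀, pFull_congr h₁, pFull_congr h₂] <;> ring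

theorem OrdersMatch.orderOf_mem {T : H × H × H} {d : Fin 3 → H} (h : OrdersMatch T d)
    (m : Fin 3) : orderOf (d m) = orderOf T.1 ∨ orderOf (d m) = orderOf T.2.1 ∨
      orderOf (d m) = orderOf T.2.2 := by
  rcases h with ⟨h₀, h₁, h₂⟩ | ⟨h₀, h₁, h₂⟩ | ⟨h₀, h₁, h₂⟩ <;> fin_cases m <;> simp [*]

theorem OrdersMatch.four_le_orderOf [Finite H] [IsSimpleGroup H] {ι : Type*} [Finite ι]
    (hnonab : ∃ a b : H, a * b ≠ b * a) {T : H × H × H} (hT : IsGenTriple T)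
    {d : ι → H} {e : Fin 3 → ι} (h : OrdersMatch T (d ∘ e)) : 4 ≤ orderOf d := by
  have hd : ∀ m, orderOf ((d ∘ e) m) ∣ orderOf d := fun m =>
    orderOf_dvd_of_pow_eq_one (congrFun (pow_orderOf_eq_one d) (e m))
  have h0 := hd 0
  have h1 := hd 1
  have h2 := hd 2
  refine hT.four_le hnonab (orderOf_pos d).ne' ?_ ?_ ?_ <;>
    rw [← orderOf_dvd_iff_pow_eq_one] <;>
    rcases h with ⟨h₀, h₁, h₂⟩ | ⟨h₀, h₁, h₂⟩ | ⟨h₀, h₁, h₂⟩ <;>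
    rw [h₀] at h0 <;> rw [h₁] at h1 <;> rw [h₂] at h2 <;> assumption

open Classical in
/-- The number of nontrivial coordinates, within a block of coordinates matching `T`, of a power
of prime order `p` is `nuP p T`. -/
theorem OrdersMatch.card_pow_ne_one [Finite H] {ι : Type*} [Finite ι] {p : ℕ} (hp : p.Prime)
    (hpe : p ∣ Monoid.exponent H) {T : H × H × H} {d : ι → H} {e : Fin 3 → ι}
    (h : OrdersMatch T (d ∘ e)) {m : ℕ} (hd : (d ^ m) ^ p = 1) (hne : d ^ m ≠ 1)
    (hT : nuP p T = 0 → (¬ p ^ 2 ∣ Monoid.exponent H ∨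
      (¬ p ∣ orderOf T.1 ∧ ¬ p ∣ orderOf T.2.1 ∧ ¬ p ∣ orderOf T.2.2))) :
    (Finset.univ.filter fun l => (d ^ m) (e l) ≠ 1).card = nuP p T := by
  by_cases h0 : nuP p T = 0
  · rw [h0, Finset.card_eq_zero, Finset.filter_eq_empty_iff]
    rintro l -
    rw [not_not]
    refine pow_apply_eq_one_of_not_dvd hp hd ?_
    rcases hT h0 with hp2 | ⟨h₁, h₂, h₃⟩
    · rw [← pFull_iff_dvd hp hpe hp2]
      have := h.card_pFull p
      rw [h0, Finset.card_eq_zero, Finset.filter_eq_empty_iff] at this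
      exact this (Finset.mem_univ l)
    · rcases h.orderOf_mem l with hl | hl | hl <;> rw [Function.comp_apply] at hl <;> rwa [hl]
  · rw [← h.card_pFull p] at h0
    obtain ⟨l₀, hl₀⟩ := Finset.card_ne_zero.1 h0
    rw [← h.card_pFull p]
    congr 1
    ext l
    rw [Finset.mem_filter, Finset.mem_filter, Ne,
      pow_apply_eq_one_iff_not_pFull hp hd hne (Finset.mem_filter.1 hl₀).2 (e l), not_not,
      Function.comp_apply]

end Orders

/-- A generating triple of the power of `H`, with a block of three coordinates matching each of the
given triples. -/
theorem exists_pi_triple {H : Type*} [Group H] [Finite H] [IsSimpleGroup H]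
    (hnonab : ∃ a b : H, a * b ≠ b * a) {t k : ℕ} (ht : 1 ≤ t) (T : Fin t → H × H × H)
    (hgen : ∀ s, IsGenTriple (T s))
    (hineq : ∀ s s' : Fin t, ∀ m m' : Fin 3, (s, m) ≠ (s', m') →
      ¬ EquivTriple (cycPerm^[(m : ℕ)] (T s)) (cycPerm^[(m' : ℕ)] (T s')))
    (e : Fin t × Fin 3 ↪ Fin k) (hk : k ≤ d2 H) :
    ∃ a b c : Fin k → H, (Subgroup.closure {a, b, c} = ⊤ ∧ a * b * c = 1 ∧
      (1 : ℚ) / (orderOf a) + 1 / (orderOf b) + 1 / (orderOf c) < 1) ∧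
      ∀ d ∈ ({a, b, c} : Set (Fin k → H)), ∀ s, OrdersMatch (T s) (d ∘ fun m => e (s, m)) := by
  obtain ⟨P, hP, hPne, hPe⟩ := exists_inequivalent_extension
    (fun r : Fin t × Fin 3 => cycPerm^[(r.2 : ℕ)] (T r.1))
    (fun r => (hgen r.1).iterate_cycPerm _) (fun r r' h => hineq r.1 r'.1 r.2 r'.2 h) e
    (by simpa using hk)
  have hpi := IsGenTriple.pi hnonab P hP hPne
  have ho : ∀ r : Fin t × Fin 3,
      orderOf (P (e r)).1 = orderOf (cycPerm^[(r.2 : ℕ)] (T r.1)).1 ∧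
      orderOf (P (e r)).2.1 = orderOf (cycPerm^[(r.2 : ℕ)] (T r.1)).2.1 ∧
      orderOf (P (e r)).2.2 = orderOf (cycPerm^[(r.2 : ℕ)] (T r.1)).2.2 := fun r => by
    obtain ⟨φ, h₁, h₂, h₃⟩ := hPe r
    refine ⟨?_, ?_, ?_⟩
    · rw [← h₁, MulEquiv.orderOf_eq]
    · rw [← h₂, MulEquiv.orderOf_eq]
    · rw [← h₃, MulEquiv.orderOf_eq]
  have hm : ∀ d ∈ ({fun j => (P j).1, fun j => (P j).2.1, fun j => (P j).2.2} :
      Set (Fin k → H)), ∀ s, OrdersMatch (T s) (d ∘ fun m => e (s, m)) := by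
    rintro d (rfl | rfl | rfl) s
    · exact Or.inl ⟨(ho (s, 0)).1, (ho (s, 1)).1, (ho (s, 2)).1⟩
    · exact Or.inr (Or.inl ⟨(ho (s, 0)).2.1, (ho (s, 1)).2.1, (ho (s, 2)).2.1⟩)
    · exact Or.inr (Or.inr ⟨(ho (s, 0)).2.2, (ho (s, 1)).2.2, (ho (s, 2)).2.2⟩)
  refine ⟨_, _, _, ⟨hpi.2, hpi.1, ?_⟩, hm⟩
  have hlt : ∀ d ∈ ({fun j => (P j).1, fun j => (P j).2.1, fun j => (P j).2.2} :
      Set (Fin k → H)), (1 : ℚ) / orderOf d ≤ 1 / 4 := fun d hd => by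
    have h4 : 4 ≤ orderOf d := (hm d hd ⟨0, ht⟩).four_le_orderOf hnonab (hgen _)
    exact one_div_le_one_div_of_le (by norm_num) (by exact_mod_cast h4)
  have h₁ := hlt _ (Set.mem_insert _ _)
  have h₂ := hlt _ (Set.mem_insert_of_mem _ (Set.mem_insert _ _))
  have h₃ := hlt _ (Set.mem_insert_of_mem _ (Set.mem_insert_of_mem _ rfl))
  linarith

/-- A power of an element of `SigmaSet a b c` has the same order and the same nontrivial coordinates
as some power of `a`, `b` or `c`. -/
theorem exists_pow_of_mem_sigmaSet {ι H : Type*} [Finite ι] [Group H] [Finite H]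
    {a b c g : ι → H} (hg : g ∈ SigmaSet a b c) (n : ℕ) :
    ∃ d ∈ ({a, b, c} : Set (ι → H)), ∃ m : ℕ, orderOf (d ^ m) = orderOf (g ^ n) ∧
      ∀ j, (d ^ m) j = 1 ↔ (g ^ n) j = 1 := by
  obtain ⟨d, hd, m, hm⟩ := hg
  obtain ⟨x, rfl⟩ := isConj_iff.1 hm
  have hmem : (d ^ m) ^ n ∈ Subgroup.zpowers d :=
    pow_mem (Subgroup.zpow_mem_zpowers d m) n
  obtain ⟨l, hl⟩ := mem_powers_iff_mem_zpowers.2 hmem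
  change d ^ l = (d ^ m) ^ n at hl
  refine ⟨d, hd, l, ?_, fun j => ?_⟩
  · rw [conj_pow, hl]
    exact ((MulAut.conj x).orderOf_eq _).symm
  · rw [conj_pow, ← hl]
    simp

theorem beauville_of_strongly_p_distinguishing
    {H : Type*} [Group H] [Finite H]
    (hsimple : IsSimpleGroup H) (hnonab : ∃ a b : H, a * b ≠ b * a)
    (t : ℕ) (ht : 1 ≤ t) (T : Fin 2 → Fin t → H × H × H)
    (hgen : ∀ i s, IsGenTriple (T i s))
    (hdist : ∀ p : ℕ, p.Prime → p ∣ Nat.card H →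
      ∃ s, StronglyPDistinguishing p (T 0 s) (T 1 s))
    (hineq : ∀ i : Fin 2, ∀ s s' : Fin t, ∀ m m' : Fin 3, (s, m) ≠ (s', m') →
      ¬ EquivTriple (cycPerm^[(m : ℕ)] (T i s)) (cycPerm^[(m' : ℕ)] (T i s')))
    (k : ℕ) (hk1 : 3 * t ≤ k) (hk2 : k ≤ d2 H) :
    IsBeauvilleGroup (Fin k → H) := by
  classical
  obtain ⟨e⟩ : Nonempty (Fin t × Fin 3 ↪ Fin k) :=
    Function.Embedding.nonempty_of_card_le (by simpa [mul_comm] using hk1)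
  obtain ⟨a₁, b₁, c₁, h₁, hm₁⟩ := exists_pi_triple hnonab ht (T 0) (hgen 0) (hineq 0) e hk2
  obtain ⟨a₂, b₂, c₂, h₂, hm₂⟩ := exists_pi_triple hnonab ht (T 1) (hgen 1) (hineq 1) e hk2
  refine ⟨a₁, b₁, c₁, a₂, b₂, c₂, h₁, h₂, Set.Subset.antisymm ?_ ?_⟩
  · rintro g ⟨hg₁, hg₂⟩
    by_contra hg
    rw [Set.mem_singleton_iff, ← orderOf_eq_one_iff] at hg
    obtain ⟨p, hp, hpg⟩ := Nat.exists_prime_and_dvd hg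
    have hcard : p ∣ Nat.card H := by
      have := hpg.trans (orderOf_dvd_natCard g)
      rw [Nat.card_fun] at this
      exact hp.dvd_of_dvd_pow this
    have hpe : p ∣ Monoid.exponent H := by
      have : Fact p.Prime := ⟨hp⟩
      obtain ⟨x, hx⟩ := exists_prime_orderOf_dvd_card' p hcard
      exact hx ▸ Monoid.order_dvd_exponent x
    obtain ⟨s, hne, hstrong⟩ := hdist p hp hcard
    have hord : orderOf (g ^ (orderOf g / p)) = p :=
      orderOf_pow_orderOf_div (orderOf_pos g).ne' hpg
    obtain ⟨d₁, hd₁, l₁, ho₁, hj₁⟩ := exists_pow_of_mem_sigmaSet hg₁ (orderOf g / p)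
    obtain ⟨d₂, hd₂, l₂, ho₂, hj₂⟩ := exists_pow_of_mem_sigmaSet hg₂ (orderOf g / p)
    rw [hord] at ho₁ ho₂
    have ne_one : ∀ {x : Fin k → H}, orderOf x = p → x ≠ 1 := fun hx h =>
      hp.one_lt.ne' (by rw [← hx, h, orderOf_one])
    refine hne ?_
    rw [← (hm₁ d₁ hd₁ s).card_pow_ne_one hp hpe (ho₁ ▸ pow_orderOf_eq_one _) (ne_one ho₁)
        (hstrong _ (by simp)),
      ← (hm₂ d₂ hd₂ s).card_pow_ne_one hp hpe (ho₂ ▸ pow_orderOf_eq_one _) (ne_one ho₂)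
        (hstrong _ (by simp))]
    simp only [Ne, hj₁, hj₂]
  · rintro _ rfl
    exact ⟨⟨a₁, by simp, 0, by simp⟩, ⟨a₂, by simp, 0, by simp⟩⟩
end

section
/- Let H be a non-abelian finite simple group possessing r mutually inequivalent generating triples of type (l, m, n), where r ≥ 2 and the integers l, m, n are pairwise coprime. Then H^k is a Beauville group for every k with 2 ≤ k ≤ 6r. -/
namespace Beauville

/-- `t` is a triple with product `1` that generates `G`. -/
def IsGenerating {G : Type*} [Group G] (t : Fin 3 → G) : Prop :=
  t 0 * t 1 * t 2 = 1 ∧ Subgroup.closure (Set.range t) = ⊤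

section Icosahedral

variable {G : Type*} [Group G]

/-- The representatives of the double cosets of `⟨z⟩` in the `(2, 3, 5)` triangle group. -/
def icosahedralRep (x z : G) : Fin 4 → G :=
  ![1, x, x * z ^ 2 * x, x * z ^ 2 * x * z ^ 3 * x]

variable {x z : G}

lemma exists_icosahedralRep_mul (hx : x * x = 1) (hz : z ^ 5 = 1) (hxz : (x * z) ^ 3 = 1)
    (w : Fin 4) (j : ℕ) :
    ∃ (w' : Fin 4) (i' j' : ℕ),
      icosahedralRep x z w * z ^ j * x = z ^ i' * icosahedralRep x z w' * z ^ j' := by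
  have hx' (g : G) : x * (x * g) = g := by rw [← mul_assoc, hx, one_mul]
  have z3 : z ^ 3 = z⁻¹ * z⁻¹ := by
    rw [eq_mul_inv_iff_mul_eq, eq_inv_iff_mul_eq_one, ← hz]; simp only [pow_succ, pow_zero, one_mul]
  have z4 : z ^ 4 = z⁻¹ := by rw [eq_inv_iff_mul_eq_one, ← pow_succ, hz]
  have zzz (g : G) : z * (z * (z * g)) = z⁻¹ * (z⁻¹ * g) := by
    simpa [pow_succ, mul_assoc] using congrArg (· * g) z3
  have h1 : x * z * x = z⁻¹ * x * z⁻¹ := by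
    rw [eq_mul_inv_iff_mul_eq, eq_inv_mul_iff_mul_eq]
    calc z * (x * z * x * z) = x * ((x * z) ^ 3) := by
          simp only [pow_succ, pow_zero, one_mul, mul_assoc, hx']
      _ = x := by rw [hxz, mul_one]
  have h1' (g : G) : x * (z * (x * g)) = z⁻¹ * (x * (z⁻¹ * g)) := by
    simpa [mul_assoc] using congrArg (· * g) h1
  have h4 : x * z⁻¹ * x = z * x * z := by
    have hxi : x⁻¹ = x := inv_eq_of_mul_eq_one_left hx
    simpa [mul_assoc, hxi] using congrArg (·⁻¹) h1
  have h3 : x * (z⁻¹ * (z⁻¹ * x)) = z * (x * (z * (z * (x * z)))) := by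
    calc x * (z⁻¹ * (z⁻¹ * x)) = (x * z⁻¹ * x) * (x * z⁻¹ * x) := by
          simp only [mul_assoc, hx']
      _ = _ := by rw [h4]; simp only [mul_assoc]
  have h3' (g : G) : x * (z⁻¹ * (z⁻¹ * (x * g))) = z * (x * (z * (z * (x * (z * g))))) := by
    simpa only [mul_assoc] using congrArg (· * g) h3
  have hu : x * z ^ 2 * x * z ^ 3 * x = z * (x * z ^ 2 * x * z ^ 3 * x) * z := by
    calc x * z ^ 2 * x * z ^ 3 * x = x * (z * (z * (x * (z⁻¹ * (z⁻¹ * x))))) := by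
          simp only [z3, pow_two, mul_assoc]
      _ = x * (z⁻¹ * (z⁻¹ * (x * (z * (z * (x * z)))))) := by rw [h3, zzz]
      _ = z * (x * (z * (z * (x * (z * (z * (z * (x * z)))))))) := by rw [h3']
      _ = _ := by rw [zzz]; simp only [z3, pow_two, mul_assoc]
  have huz (j : ℕ) : x * z ^ 2 * x * z ^ 3 * x * z ^ j
      = z ^ (4 * j) * (x * z ^ 2 * x * z ^ 3 * x) := by
    induction j with
    | zero => simp
    | succ j ih =>
      rw [pow_succ z j, ← mul_assoc, ih, mul_add, pow_add, mul_assoc, mul_assoc _ (z ^ (4 * 1))]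
      congr 1
      rw [mul_one, z4, eq_inv_mul_iff_mul_eq, ← mul_assoc, ← hu]
  fin_cases w
  · exact ⟨1, j, 0, by simp [icosahedralRep]⟩
  · change ∃ (w' : Fin 4) (i' j' : ℕ), x * z ^ j * x = z ^ i' * icosahedralRep x z w' * z ^ j'
    rw [pow_eq_pow_mod j hz]
    have hj : j % 5 < 5 := Nat.mod_lt _ (by norm_num)
    interval_cases j % 5
    · exact ⟨0, 0, 0, by simp [icosahedralRep, hx]⟩
    · exact ⟨1, 4, 4, by simp [icosahedralRep, z4, h1]⟩
    · exact ⟨2, 0, 0, by simp [icosahedralRep]⟩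
    · exact ⟨2, 1, 1, by simp [icosahedralRep, z3, mul_assoc, h3, pow_two]⟩
    · exact ⟨1, 1, 1, by simp [icosahedralRep, z4, h4]⟩
  · change ∃ (w' : Fin 4) (i' j' : ℕ),
      x * z ^ 2 * x * z ^ j * x = z ^ i' * icosahedralRep x z w' * z ^ j'
    rw [pow_eq_pow_mod j hz]
    have hj : j % 5 < 5 := Nat.mod_lt _ (by norm_num)
    have h1r : x * (z * x) = z⁻¹ * (x * z⁻¹) := by simpa only [mul_assoc] using h1
    have h4r : x * (z⁻¹ * x) = z * (x * z) := by simpa only [mul_assoc] using h4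
    interval_cases j % 5
    · exact ⟨1, 0, 2, by simp [icosahedralRep, mul_assoc, hx]⟩
    · exact ⟨1, 4, 3, by simp [icosahedralRep, z3, z4, mul_assoc, h1r, h1', pow_two]⟩
    · refine ⟨2, 4, 4, ?_⟩
      have h2 : x * (z * (z * x)) = z⁻¹ * (x * (z⁻¹ * (z⁻¹ * (x * z⁻¹)))) := by
        calc x * (z * (z * x)) = (x * z * x) * (x * z * x) := by simp only [mul_assoc, hx']
          _ = _ := by rw [h1]; simp only [mul_assoc]
      have z3' (g : G) : z⁻¹ * (z⁻¹ * (z⁻¹ * g)) = z * (z * g) := by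
        rw [← zzz, mul_inv_cancel_left]
      calc x * z ^ 2 * x * z ^ 2 * x = x * (z * (z * (x * (z * (z * x))))) := by
            simp only [pow_two, mul_assoc]
        _ = z⁻¹ * (x * (z⁻¹ * (z⁻¹ * (z⁻¹ * (x * z⁻¹))))) := by
            rw [h2, mul_inv_cancel_left, h1']
        _ = _ := by rw [z3']; simp [icosahedralRep, z4, pow_two, mul_assoc]
    · exact ⟨3, 0, 0, by simp [icosahedralRep]⟩
    · refine ⟨2, 1, 2, ?_⟩
      calc x * z ^ 2 * x * z ^ 4 * x = x * (z * (z * (z * (x * z)))) := by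
            simp only [pow_two, z4, mul_assoc, h4r]
        _ = z * (x * (z * (z * (x * (z * z))))) := by rw [zzz, h3']
        _ = _ := by simp [icosahedralRep, pow_two, mul_assoc]
  · refine ⟨2, 4 * j, 3, ?_⟩
    change x * z ^ 2 * x * z ^ 3 * x * z ^ j * x = z ^ (4 * j) * (x * z ^ 2 * x) * z ^ 3
    rw [huz]
    simp only [mul_assoc, hx, mul_one]

lemma mem_range_icosahedralRep (hx : x * x = 1) (hz : z ^ 5 = 1) (hxz : (x * z) ^ 3 = 1)
    {g : G} (hg : g ∈ Subgroup.closure {x, z}) :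
    ∃ (w : Fin 4) (i j : ℕ), g = z ^ i * icosahedralRep x z w * z ^ j := by
  have z4 : z⁻¹ = z ^ 4 := by rw [eq_comm, eq_inv_iff_mul_eq_one, ← pow_succ, hz]
  have hxi : x⁻¹ = x := inv_eq_of_mul_eq_one_left hx
  have mulx {g : G} (h : ∃ (w : Fin 4) (i j : ℕ), g = z ^ i * icosahedralRep x z w * z ^ j) :
      ∃ (w : Fin 4) (i j : ℕ), g * x = z ^ i * icosahedralRep x z w * z ^ j := by
    obtain ⟨w, i, j, rfl⟩ := h
    obtain ⟨w', i', j', h'⟩ := exists_icosahedralRep_mul hx hz hxz w j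
    refine ⟨w', i + i', j', ?_⟩
    rw [pow_add, mul_assoc (z ^ i), mul_assoc, h']
    simp only [mul_assoc]
  have mulz (n : ℕ) {g : G}
      (h : ∃ (w : Fin 4) (i j : ℕ), g = z ^ i * icosahedralRep x z w * z ^ j) :
      ∃ (w : Fin 4) (i j : ℕ), g * z ^ n = z ^ i * icosahedralRep x z w * z ^ j := by
    obtain ⟨w, i, j, rfl⟩ := h
    exact ⟨w, i, j + n, by simp only [pow_add, mul_assoc]⟩
  induction hg using Subgroup.closure_induction_right with
  | one => exact ⟨0, 0, 0, by simp [icosahedralRep]⟩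
  | mul_right g _ y hy ih =>
    obtain rfl | rfl := hy
    · exact mulx ih
    · simpa using mulz 1 ih
  | mul_inv_cancel g _ y hy ih =>
    obtain rfl | rfl := hy
    · rw [hxi]; exact mulx ih
    · rw [z4]; exact mulz 4 ih

lemma card_le_of_icosahedral (hx : x * x = 1) (hz : z ^ 5 = 1) (hxz : (x * z) ^ 3 = 1)
    (h : Subgroup.closure {x, z} = ⊤) : Nat.card G ≤ 100 := by
  let f : Fin 4 × Fin 5 × Fin 5 → G := fun p ↦
    z ^ (p.2.1 : ℕ) * icosahedralRep x z p.1 * z ^ (p.2.2 : ℕ)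
  have hf : Function.Surjective f := by
    intro g
    obtain ⟨w, i, j, rfl⟩ := mem_range_icosahedralRep hx hz hxz (h ▸ Subgroup.mem_top g)
    refine ⟨(w, ⟨i % 5, Nat.mod_lt _ (by norm_num)⟩, ⟨j % 5, Nat.mod_lt _ (by norm_num)⟩), ?_⟩
    simp only [f, ← pow_eq_pow_mod _ hz]
  simpa using Nat.card_le_card_of_surjective f hf

lemma IsGenerating.closure_pair {t : Fin 3 → G} (ht : IsGenerating t) :
    Subgroup.closure {t 0, t 2} = ⊤ := by
  rw [eq_top_iff, ← ht.2, Subgroup.closure_le]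
  have h0 : t 0 ∈ Subgroup.closure {t 0, t 2} := Subgroup.subset_closure (by simp)
  have h2 : t 2 ∈ Subgroup.closure {t 0, t 2} := Subgroup.subset_closure (by simp)
  have h1 : t 1 = (t 0)⁻¹ * (t 2)⁻¹ := by
    have h : t 1 = (t 0)⁻¹ * (t 0 * t 1 * t 2) * (t 2)⁻¹ := by group
    rwa [ht.1, mul_one] at h
  rintro _ ⟨v, rfl⟩
  fin_cases v
  · exact h0
  · exact h1 ▸ mul_mem (inv_mem h0) (inv_mem h2)
  · exact h2

lemma IsGenerating.card_le {t : Fin 3 → G} (ht : IsGenerating t) (h0 : t 0 ^ 2 = 1)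
    (h1 : t 1 ^ 3 = 1) (h2 : t 2 ^ 5 = 1) : Nat.card G ≤ 100 := by
  have h20 : t 0 * t 2 = (t 0 * t 1 * (t 0)⁻¹)⁻¹ := by
    have h12 : t 2 = (t 0 * t 1)⁻¹ := eq_inv_of_mul_eq_one_right ht.1
    rw [h12]
    group
  refine card_le_of_icosahedral (by rw [← pow_two, h0]) h2 ?_ ht.closure_pair
  rw [h20, inv_pow, conj_pow, h1]
  simp

end Icosahedral

section Generation

variable {G H : Type*} [Group G] [Group H] [IsSimpleGroup H]

lemma exists_eq_and_eq_one_or_exists_mulEquiv {f g : G →* H} (hf : Function.Surjective f)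
    (hg : Function.Surjective g) :
    (∀ h, ∃ k, f k = h ∧ g k = 1) ∨ ∃ φ : H ≃* H, ∀ k, φ (f k) = g k := by
  have key {f g : G →* H} (hf : Function.Surjective f) :
      (∀ h, ∃ k, f k = h ∧ g k = 1) ∨ g.ker ≤ f.ker := by
    have hN : (g.ker.map f).Normal := Subgroup.Normal.map inferInstance f hf
    rcases hN.eq_bot_or_eq_top with h | h
    · exact Or.inr ((Subgroup.map_eq_bot_iff _).1 h)
    · refine Or.inl fun x ↦ ?_
      obtain ⟨k, hk, rfl⟩ := h ▸ Subgroup.mem_top x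
      exact ⟨k, rfl, hk⟩
  rcases key (g := g) hf with h | hgf
  · exact Or.inl h
  rcases key (g := f) hg with h | hfg
  · refine Or.inl fun x ↦ ?_
    obtain ⟨k, rfl⟩ := hf x
    obtain ⟨k', hk', hk1⟩ := h (g k)
    have : f (k * k'⁻¹) = 1 := hgf (by simp [MonoidHom.mem_ker, hk'])
    exact ⟨1, by simpa [hk1, eq_comm] using this, map_one g⟩
  · exact Or.inr ⟨(QuotientGroup.quotientKerEquivOfSurjective f hf).symm.trans
      ((QuotientGroup.quotientMulEquivOfEq (le_antisymm hfg hgf)).trans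
        (QuotientGroup.quotientKerEquivOfSurjective g hg)), fun k ↦ by
      have : (QuotientGroup.quotientKerEquivOfSurjective f hf).symm (f k)
          = (QuotientGroup.mk k : G ⧸ f.ker) := by
        rw [MulEquiv.symm_apply_eq]; rfl
      simp only [MulEquiv.trans_apply, this]
      rfl⟩

lemma exists_eq_and_forall_eq_one (hnonab : ∃ a b : H, a * b ≠ b * a) {ι : Type*}
    {p : ι → G →* H} (hp : ∀ i, Function.Surjective (p i))
    (hpair : ∀ i j, i ≠ j → ¬ ∃ φ : H ≃* H, ∀ k, φ (p i k) = p j k)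
    (i : ι) (S : Finset ι) (hi : i ∉ S) (h : H) :
    ∃ k, p i k = h ∧ ∀ j ∈ S, p j k = 1 := by
  classical
  induction S using Finset.induction_on generalizing h with
  | empty => simpa using hp i h
  | insert j S _ ih =>
    rw [Finset.mem_insert, not_or] at hi
    have hN : ((⨅ j' ∈ insert j S, (p j').ker).map (p i)).Normal :=
      Subgroup.Normal.map (Subgroup.normal_iInf_normal fun _ ↦
        Subgroup.normal_iInf_normal fun _ ↦ inferInstance) _ (hp i)
    have mem_iff (x : H) : x ∈ (⨅ j' ∈ insert j S, (p j').ker).map (p i) ↔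
        ∃ k, p i k = x ∧ ∀ j' ∈ insert j S, p j' k = 1 := by
      simp only [Subgroup.mem_map, Subgroup.mem_iInf, MonoidHom.mem_ker, and_comm]
    rw [← mem_iff]
    rcases hN.eq_bot_or_eq_top with hbot | htop
    · obtain ⟨a, b, hab⟩ := hnonab
      obtain ⟨ka, rfl, ha⟩ := ih hi.2 a
      obtain ⟨kb, rfl, hb⟩ := ((exists_eq_and_eq_one_or_exists_mulEquiv (hp i) (hp j)).resolve_right
        (hpair i j hi.1)) b
      refine absurd ?_ hab
      rw [← commutatorElement_eq_one_iff_mul_comm, ← map_commutatorElement, ← Subgroup.mem_bot,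
        ← hbot, mem_iff]
      refine ⟨_, rfl, fun j' hj' ↦ ?_⟩
      rw [map_commutatorElement]
      obtain rfl | hj' := Finset.mem_insert.1 hj'
      · rw [hb, commutatorElement_one_right]
      · rw [ha j' hj', commutatorElement_one_left]
    · rw [htop]; trivial

lemma closure_pi_eq_top (hnonab : ∃ a b : H, a * b ≠ b * a) {ι κ : Type*} [Finite ι]
    {t : ι → κ → H} (hgen : ∀ i, Subgroup.closure (Set.range (t i)) = ⊤)
    (hpair : ∀ i j, i ≠ j → ¬ ∃ φ : H ≃* H, ∀ v, φ (t i v) = t j v) :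
    Subgroup.closure (Set.range fun v i ↦ t i v) = ⊤ := by
  classical
  have := Fintype.ofFinite ι
  set K := Subgroup.closure (Set.range fun v i ↦ t i v)
  let p (i : ι) : K →* H := (Pi.evalMonoidHom (fun _ : ι ↦ H) i).comp K.subtype
  have hmem (v : κ) : (fun i ↦ t i v) ∈ K := Subgroup.subset_closure ⟨v, rfl⟩
  have hp (i : ι) : Function.Surjective (p i) := by
    rw [← MonoidHom.range_eq_top, eq_top_iff, ← hgen i, Subgroup.closure_le]
    rintro _ ⟨v, rfl⟩
    exact ⟨⟨_, hmem v⟩, rfl⟩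
  rw [eq_top_iff]
  intro x _
  refine Subgroup.pi_mem_of_mulSingle_mem x fun i ↦ ?_
  obtain ⟨k, hk, hk1⟩ := exists_eq_and_forall_eq_one hnonab hp
    (fun i j hij ⟨φ, hφ⟩ ↦ hpair i j hij ⟨φ, fun v ↦ hφ ⟨_, hmem v⟩⟩)
    i (Finset.univ.erase i) (Finset.notMem_erase i _) (x i)
  convert k.2
  funext j
  obtain rfl | hj := eq_or_ne j i
  · rw [Pi.mulSingle_eq_same, ← hk]; rfl
  · rw [Pi.mulSingle_eq_of_ne hj]
    exact (hk1 j (by simp [hj])).symm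

end Generation

lemma range_fin_three {α : Type*} (t : Fin 3 → α) : Set.range t = {t 0, t 1, t 2} := by
  ext x
  simp [Fin.exists_fin_succ, eq_comm]

section Rearrange

variable {G : Type*} [Group G]

open Equiv.Perm

/-- The triple `t` permuted by `π`, with its elements inverted when `π` is odd so that the product
remains `1`. -/
def rearrange (π : Equiv.Perm (Fin 3)) (t : Fin 3 → G) (v : Fin 3) : G :=
  t (π v) ^ (sign π : ℤ)

lemma orderOf_rearrange (π : Equiv.Perm (Fin 3)) (t : Fin 3 → G) (v : Fin 3) :
    orderOf (rearrange π t v) = orderOf (t (π v)) := by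
  rcases Int.units_eq_one_or (sign π) with h | h <;> simp [rearrange, h]

lemma IsGenerating.rearrange {t : Fin 3 → G} (ht : IsGenerating t) (π : Equiv.Perm (Fin 3)) :
    IsGenerating (rearrange π t) := by
  constructor
  · have hπ : ∀ π : Equiv.Perm (Fin 3),
        sign π = 1 ∧ (π 0 = 0 ∧ π 1 = 1 ∧ π 2 = 2 ∨ π 0 = 1 ∧ π 1 = 2 ∧ π 2 = 0 ∨
          π 0 = 2 ∧ π 1 = 0 ∧ π 2 = 1) ∨
        sign π = -1 ∧ (π 2 = 0 ∧ π 1 = 1 ∧ π 0 = 2 ∨ π 2 = 1 ∧ π 1 = 2 ∧ π 0 = 0 ∨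
          π 2 = 2 ∧ π 1 = 0 ∧ π 0 = 1) := by decide
    have h0 := ht.1
    have h1 : t 1 * t 2 * t 0 = 1 := by
      rwa [mul_assoc, mul_eq_one_comm] at h0
    have h2 : t 2 * t 0 * t 1 = 1 := by
      rwa [mul_assoc, mul_eq_one_comm] at h1
    rcases hπ π with ⟨hs, ⟨ha, hb, hc⟩ | ⟨ha, hb, hc⟩ | ⟨ha, hb, hc⟩⟩ |
      ⟨hs, ⟨ha, hb, hc⟩ | ⟨ha, hb, hc⟩ | ⟨ha, hb, hc⟩⟩ <;>
      simp only [Beauville.rearrange, hs, ha, hb, hc, Units.val_one, zpow_one, Units.val_neg,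
        zpow_neg, ← mul_inv_rev, ← mul_assoc, inv_eq_one, h0, h1, h2]
  · rw [eq_top_iff, ← ht.2, Subgroup.closure_le]
    rintro _ ⟨v, rfl⟩
    have h : t v = Beauville.rearrange π t (π⁻¹ v) ^ (sign π : ℤ) := by
      rcases Int.units_eq_one_or (sign π) with h | h <;> simp [Beauville.rearrange, h]
    rw [h]
    exact zpow_mem (Subgroup.subset_closure (Set.mem_range_self _)) _

lemma exists_mulEquiv_of_rearrange {L : Fin 3 → ℕ} (hL : Function.Injective L) {t t' : Fin 3 → G}
    (ht : ∀ v, orderOf (t v) = L v) (ht' : ∀ v, orderOf (t' v) = L v) {π π' : Equiv.Perm (Fin 3)}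
    {φ : G ≃* G} (hφ : ∀ v, φ (rearrange π t v) = rearrange π' t' v) :
    π = π' ∧ ∀ v, φ (t v) = t' v := by
  have hπ : π = π' := by
    ext v : 1
    apply hL
    rw [← ht, ← ht', ← orderOf_rearrange, ← orderOf_rearrange, ← hφ, MulEquiv.orderOf_eq]
  subst hπ
  refine ⟨rfl, fun v ↦ ?_⟩
  have h := hφ (π⁻¹ v)
  rcases Int.units_eq_one_or (sign π) with hs | hs <;> simpa [rearrange, hs] using h

end Rearrange

section Order

variable {H : Type*} [Group H]

lemma IsGenerating.ne_one {t : Fin 3 → H} (ht : IsGenerating t)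
    (hnonab : ∃ a b : H, a * b ≠ b * a) (v : Fin 3) : t v ≠ 1 := by
  intro hv
  have hcomm (i j : Fin 3) : t i * t j = t j * t i := by
    have h := ht.1
    fin_cases v <;> simp only [Fin.zero_eta, Fin.mk_one, Fin.reduceFinMk] at hv <;>
      rw [hv] at h <;> simp only [one_mul, mul_one] at h <;>
      rw [mul_eq_one_iff_eq_inv] at h <;>
      fin_cases i <;> fin_cases j <;> simp [hv, h]
  obtain ⟨a, b, hab⟩ := hnonab
  refine hab ?_
  have hle : (⊤ : Subgroup H) ≤ Subgroup.centralizer (Subgroup.centralizer (Set.range t)) :=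
    ht.2 ▸ Subgroup.closure_le_centralizer_centralizer _
  have hle' : (⊤ : Subgroup H) ≤ Subgroup.centralizer (Set.range t) := by
    rw [← ht.2, Subgroup.closure_le]
    rintro _ ⟨i, rfl⟩
    rw [SetLike.mem_coe, Subgroup.mem_centralizer_iff]
    rintro _ ⟨j, rfl⟩
    exact hcomm j i
  exact (Subgroup.mem_centralizer_iff.1 (hle (Subgroup.mem_top a)) b
    (hle' (Subgroup.mem_top b))).symm

lemma sum_one_div_lt_one_or {L : Fin 3 → ℕ} (hL : Pairwise fun u v ↦ (L u).Coprime (L v))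
    (hL2 : ∀ v, 2 ≤ L v) :
    ∑ v, 1 / (L v : ℚ) < 1 ∨
      ∃ π : Equiv.Perm (Fin 3), L (π 0) = 2 ∧ L (π 1) = 3 ∧ L (π 2) = 5 := by
  set π := Tuple.sort L
  have hmono := Tuple.monotone_sort L
  have h01 : L (π 0) ≤ L (π 1) := hmono (by decide)
  have h12 : L (π 1) ≤ L (π 2) := hmono (by decide)
  have c01 : (L (π 0)).Coprime (L (π 1)) := hL (by simp)
  have c02 : (L (π 0)).Coprime (L (π 2)) := hL (by simp)
  have c12 : (L (π 1)).Coprime (L (π 2)) := hL (by simp)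
  have key : ∀ a b c : ℕ, 2 ≤ a → a ≤ b → b ≤ c → a.Coprime b → a.Coprime c → b.Coprime c →
      (a = 2 ∧ b = 3 ∧ c = 5) ∨ 1 / (a : ℚ) + 1 / (b : ℚ) + 1 / (c : ℚ) < 1 := by
    intro a b c ha hab hbc cab cac cbc
    by_cases hc : c < 7
    · have : b < 7 := by omega
      have : a < 7 := by omega
      interval_cases c <;> interval_cases b <;> interval_cases a <;> first
        | (exfalso; revert cab cac cbc; decide)
        | norm_num
    · have hb : 3 ≤ b := by
        by_contra hb
        obtain rfl : b = 2 := by omega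
        obtain rfl : a = 2 := by omega
        revert cab; decide
      right
      have h1 : 1 / (a : ℚ) ≤ 1 / 2 := one_div_le_one_div_of_le (by norm_num) (by exact_mod_cast ha)
      have h2 : 1 / (b : ℚ) ≤ 1 / 3 := one_div_le_one_div_of_le (by norm_num) (by exact_mod_cast hb)
      have h3 : 1 / (c : ℚ) ≤ 1 / 7 :=
        one_div_le_one_div_of_le (by norm_num) (by exact_mod_cast not_lt.1 hc)
      linarith
  rcases key _ _ _ (hL2 _) h01 h12 c01 c02 c12 with h | h
  · exact Or.inr ⟨π, h⟩
  · refine Or.inl ?_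
    rwa [← Equiv.sum_comp π, Fin.sum_univ_three]

end Order

section Assignment

lemma exists_perm_assignments {r k : ℕ} (hr : 2 ≤ r) (hk : 2 ≤ k) (hkr : k ≤ 6 * r) :
    ∃ σ τ : Fin k → Equiv.Perm (Fin 3) × Fin r, Function.Injective σ ∧ Function.Injective τ ∧
      ∀ s v w, (∃ i, (σ i).1 v = s) → ¬ ∀ i, (σ i).1 v = s ↔ (τ i).1 w = s := by
  let f (i : Fin (6 * r)) : Equiv.Perm (Fin 3) × Fin r :=
    (Equiv.addRight (Fin.ofNat 3 (i / 2)), ⟨i % 2, by omega⟩)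
  have hf : Set.InjOn f {i | (i : ℕ) < 6} := by
    intro i hi j hj hij
    simp only [f, Prod.mk.injEq, Fin.mk.injEq] at hij
    have h := congrArg Fin.val (Equiv.congr_fun hij.1 0)
    simp only [Set.mem_ofPred_eq, Equiv.coe_addRight, zero_add, Fin.val_ofNat] at hi hj h
    ext
    omega
  obtain ⟨e, he⟩ := Set.MapsTo.exists_equiv_extend_of_card_eq
    (t := (Finset.univ : Finset (Equiv.Perm (Fin 3) × Fin r)))
    (by simp [Fintype.card_perm, Nat.factorial]) (fun _ _ ↦ by simp) hf
  let shift (i : Fin (6 * r)) : Fin (6 * r) :=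
    ⟨if (i : ℕ) < 5 then i + 1 else if (i : ℕ) = 5 then 0 else i, by split_ifs <;> omega⟩
  have hshift : Function.Injective shift := by
    intro i j hij
    have h := congrArg Fin.val hij
    simp only [shift] at h
    ext
    split_ifs at h <;> omega
  have hinj : Function.Injective fun i ↦ (e i : Equiv.Perm (Fin 3) × Fin r) :=
    Subtype.val_injective.comp e.injective
  have hcast : Function.Injective (Fin.castLE hkr) := Fin.castLE_injective hkr
  refine ⟨fun i ↦ e (i.castLE hkr), fun i ↦ e (shift (i.castLE hkr)), hinj.comp hcast,
    hinj.comp (hshift.comp hcast), ?_⟩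
  have hσ (i : ℕ) (hi : i < k) (hi6 : i < 6) (v : Fin 3) :
      (e (Fin.castLE hkr ⟨i, hi⟩)).1.1 v = v + Fin.ofNat 3 (i / 2) := by
    rw [he _ hi6]; rfl
  have hτ (i : ℕ) (hi : i < k) (hi6 : i < 5) (v : Fin 3) :
      (e (shift (Fin.castLE hkr ⟨i, hi⟩))).1.1 v = v + Fin.ofNat 3 ((i + 1) / 2) := by
    rw [he]
    · simp [f, shift, hi6]
    · simp [shift, hi6]; omega
  rintro s v w ⟨i, hi⟩ h
  obtain ⟨c, rfl⟩ : ∃ c : Fin 3, s = v + c := ⟨s - v, by abel⟩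
  have hck : 2 * (c : ℕ) < k := by
    by_contra hck
    have hi6 : (i : ℕ) < 6 := by omega
    have := hσ i i.2 hi6 v
    rw [Fin.eta, hi, add_right_inj] at this
    have := congrArg Fin.val this
    simp only [Fin.val_ofNat] at this
    omega
  have hs := h ⟨2 * c, hck⟩
  rw [hσ _ _ (by omega), hτ _ _ (by omega)] at hs
  clear hi
  fin_cases c
  · have hs' := h ⟨1, by omega⟩
    rw [hσ _ _ (by omega), hτ _ _ (by omega)] at hs'
    clear h; revert v w; decide
  · have hs' := h ⟨1, by omega⟩
    rw [hσ _ _ (by omega), hτ _ _ (by omega)] at hs'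
    clear h; revert v w; decide
  · have hs' := h ⟨3, by simp at hck; omega⟩
    rw [hσ _ _ (by omega), hτ _ _ (by omega)] at hs'
    clear h; revert v w; decide

end Assignment

section Sigma

lemma exists_pow_eq_one_iff_of_mem_sigmaSet {ι H : Type*} [Group H] {U : Fin 3 → ι → H}
    {g : ι → H} (hg : g ∈ SigmaSet (U 0) (U 1) (U 2)) :
    ∃ (v : Fin 3) (m : ℤ), ∀ i (N : ℕ), g i ^ N = 1 ↔ (orderOf (U v i) : ℤ) ∣ m * N := by
  obtain ⟨d, hd, m, hdg⟩ := hg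
  rw [← range_fin_three] at hd
  obtain ⟨v, rfl⟩ := hd
  obtain ⟨c, rfl⟩ := isConj_iff.1 hdg
  refine ⟨v, m, fun i N ↦ ?_⟩
  rw [orderOf_dvd_iff_zpow_eq_one, zpow_mul, zpow_natCast, Pi.mul_apply, Pi.mul_apply,
    Pi.inv_apply, Pi.pow_apply, conj_pow, conj_eq_one_iff]

lemma not_dvd_mul_prod_erase_iff {ι : Type*} {L : Fin 3 → ℕ} {ρ : ι → Fin 3} {s : Fin 3} {m : ℤ}
    (h : ∃ i, ¬ (L (ρ i) : ℤ) ∣ m * (∏ u ∈ Finset.univ.erase s, L u : ℕ)) (i : ι) :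
    ¬ (L (ρ i) : ℤ) ∣ m * (∏ u ∈ Finset.univ.erase s, L u : ℕ) ↔ ρ i = s := by
  have hdvd {i : ι} (hi : ρ i ≠ s) : (L (ρ i) : ℤ) ∣ m * (∏ u ∈ Finset.univ.erase s, L u : ℕ) :=
    Dvd.dvd.mul_left (Int.natCast_dvd_natCast.2 (Finset.dvd_prod_of_mem L (by simp [hi]))) m
  obtain ⟨i₀, hi₀⟩ := h
  have h₀ : ρ i₀ = s := by
    by_contra h
    exact hi₀ (hdvd h)
  refine ⟨fun hi ↦ ?_, fun hi ↦ ?_⟩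
  · by_contra h
    exact hi (hdvd h)
  · rw [hi]
    rwa [h₀] at hi₀

lemma eq_one_of_mem_sigmaSet_inter {ι H : Type*} [Group H] {L : Fin 3 → ℕ}
    (hL : Pairwise fun u v ↦ (L u).Coprime (L v)) {σ τ : ι → Equiv.Perm (Fin 3)}
    {U U' : Fin 3 → ι → H} (hU : ∀ v i, orderOf (U v i) = L (σ i v))
    (hU' : ∀ v i, orderOf (U' v i) = L (τ i v))
    (hστ : ∀ s v w, (∃ i, σ i v = s) → ¬ ∀ i, σ i v = s ↔ τ i w = s)
    {g : ι → H} (hg : g ∈ SigmaSet (U 0) (U 1) (U 2)) (hg' : g ∈ SigmaSet (U' 0) (U' 1) (U' 2)) :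
    g = 1 := by
  by_contra hne
  obtain ⟨i₀, hi₀⟩ := Function.ne_iff.1 hne
  obtain ⟨v, m, hv⟩ := exists_pow_eq_one_iff_of_mem_sigmaSet hg
  obtain ⟨w, m', hw⟩ := exists_pow_eq_one_iff_of_mem_sigmaSet hg'
  simp only [hU] at hv
  simp only [hU'] at hw
  set s := σ i₀ v with hs
  set N := ∏ u ∈ Finset.univ.erase s, L u
  have hNs : (L s).Coprime N :=
    Nat.Coprime.prod_right fun u hu ↦ hL (Finset.ne_of_mem_erase hu).symm
  have hgN : ¬ g i₀ ^ N = 1 := by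
    rw [hv, ← hs]
    intro h
    have h' := (Nat.isCoprime_iff_coprime.2 hNs).dvd_of_dvd_mul_right h
    refine hi₀ ?_
    rw [← pow_one (g i₀), Pi.one_apply, hv, ← hs]
    simpa using h'
  refine hστ s v w ⟨i₀, rfl⟩ fun i ↦ ?_
  rw [← not_dvd_mul_prod_erase_iff (ρ := fun i ↦ σ i v) ⟨i₀, fun h ↦ hgN ((hv _ _).2 h)⟩ i,
    ← not_dvd_mul_prod_erase_iff (ρ := fun i ↦ τ i w) ⟨i₀, fun h ↦ hgN ((hw _ _).2 h)⟩ i,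
    ← hv, ← hw]

lemma isBeauvilleGroup_of_isGenerating {G : Type*} [Group G] {U U' : Fin 3 → G}
    (hU : IsGenerating U) (hU' : IsGenerating U')
    (h : ∑ v, 1 / (orderOf (U v) : ℚ) < 1) (h' : ∑ v, 1 / (orderOf (U' v) : ℚ) < 1)
    (hinter : ∀ g, g ∈ SigmaSet (U 0) (U 1) (U 2) → g ∈ SigmaSet (U' 0) (U' 1) (U' 2) → g = 1) :
    IsBeauvilleGroup G := by
  have one_mem (a b c : G) : (1 : G) ∈ SigmaSet a b c := ⟨a, by simp, 0, by simp⟩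
  rw [Fin.sum_univ_three] at h h'
  refine ⟨U 0, U 1, U 2, U' 0, U' 1, U' 2, ⟨?_, hU.1, h⟩, ⟨?_, hU'.1, h'⟩, ?_⟩
  · rw [← range_fin_three, hU.2]
  · rw [← range_fin_three, hU'.2]
  · ext g
    exact ⟨fun hg ↦ hinter g hg.1 hg.2, fun hg ↦ by rw [hg]; exact ⟨one_mem _ _ _, one_mem _ _ _⟩⟩

end Sigma

section Families

variable {H : Type*} [Group H] {r : ℕ} {L : Fin 3 → ℕ} {t : Fin r → Fin 3 → H}

lemma isGenerating_pi [IsSimpleGroup H] (hnonab : ∃ a b : H, a * b ≠ b * a)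
    (hL : Function.Injective L) (hgen : ∀ j, IsGenerating (t j))
    (htype : ∀ j v, orderOf (t j v) = L v)
    (hineq : ∀ j j', j ≠ j' → ¬ ∃ φ : H ≃* H, ∀ v, φ (t j v) = t j' v)
    {ι : Type*} [Finite ι] {σ : ι → Equiv.Perm (Fin 3) × Fin r} (hσ : Function.Injective σ) :
    IsGenerating fun v i ↦ rearrange (σ i).1 (t (σ i).2) v := by
  have hgen' (i : ι) := (hgen (σ i).2).rearrange (σ i).1
  refine ⟨funext fun i ↦ (hgen' i).1, closure_pi_eq_top hnonab (fun i ↦ (hgen' i).2) ?_⟩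
  rintro i j hij ⟨φ, hφ⟩
  obtain ⟨h1, h2⟩ := exists_mulEquiv_of_rearrange hL (htype _) (htype _) hφ
  refine hineq (σ i).2 (σ j).2 (fun h ↦ hij (hσ (Prod.ext h1 h))) ⟨φ, h2⟩

lemma sum_one_div_orderOf_pi_lt_one [Finite H] (hsum : ∑ v, 1 / (L v : ℚ) < 1)
    (htype : ∀ j v, orderOf (t j v) = L v) {ι : Type*} [Finite ι] [Nonempty ι]
    (σ : ι → Equiv.Perm (Fin 3) × Fin r) :
    ∑ v, 1 / (orderOf (fun i ↦ rearrange (σ i).1 (t (σ i).2) v) : ℚ) < 1 := by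
  obtain ⟨i⟩ := ‹Nonempty ι›
  refine lt_of_le_of_lt ?_ hsum
  rw [← Equiv.sum_comp (σ i).1 fun v ↦ 1 / (L v : ℚ)]
  refine Finset.sum_le_sum fun v _ ↦ ?_
  have h1 : orderOf (rearrange (σ i).1 (t (σ i).2) v) = L ((σ i).1 v) := by
    rw [orderOf_rearrange, htype]
  have h2 := orderOf_map_dvd (Pi.evalMonoidHom (fun _ : ι ↦ H) i)
    fun i ↦ rearrange (σ i).1 (t (σ i).2) v
  rw [Pi.evalMonoidHom_apply, h1] at h2
  refine one_div_le_one_div_of_le ?_ (by exact_mod_cast Nat.le_of_dvd (orderOf_pos _) h2)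
  rw [← h1]
  exact_mod_cast orderOf_pos _

lemma not_exists_icosahedral_type [IsSimpleGroup H] [Finite H] (hr : 2 ≤ r)
    (hnonab : ∃ a b : H, a * b ≠ b * a)
    (hL : Function.Injective L) (hgen : ∀ j, IsGenerating (t j))
    (htype : ∀ j v, orderOf (t j v) = L v)
    (hineq : ∀ j j', j ≠ j' → ¬ ∃ φ : H ≃* H, ∀ v, φ (t j v) = t j' v) :
    ¬ ∃ π : Equiv.Perm (Fin 3), L (π 0) = 2 ∧ L (π 1) = 3 ∧ L (π 2) = 5 := by
  rintro ⟨π, h0, h1, h2⟩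
  have hσ : Function.Injective fun i : Fin 2 ↦ (π, Fin.castLE hr i) := fun i j hij ↦
    Fin.castLE_injective hr (Prod.ext_iff.1 hij).2
  have hcard := (isGenerating_pi hnonab hL hgen htype hineq hσ).card_le
    (funext fun i ↦ ?_) (funext fun i ↦ ?_) (funext fun i ↦ ?_)
  · rw [Nat.card_fun, Nat.card_fin] at hcard
    have hdvd (v : Fin 3) : L (π v) ∣ Nat.card H := htype ⟨0, by omega⟩ _ ▸ orderOf_dvd_natCard _
    have h30 : 30 ∣ Nat.card H := by
      have h2' := h0 ▸ hdvd 0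
      have h3' := h1 ▸ hdvd 1
      have h5' := h2 ▸ hdvd 2
      omega
    have := Nat.le_of_dvd Nat.card_pos h30
    nlinarith
  all_goals
    rw [Pi.pow_apply, Pi.one_apply, ← orderOf_dvd_iff_pow_eq_one, orderOf_rearrange, htype]
    simp [*]

end Families

end Beauville

open Beauville

theorem beauville_of_coprime_type_triples
    {H : Type*} [Group H] [Finite H]
    (hsimple : IsSimpleGroup H) (hnonab : ∃ a b : H, a * b ≠ b * a)
    (r : ℕ) (hr : 2 ≤ r) (l m n : ℕ)
    (hlm : Nat.Coprime l m) (hln : Nat.Coprime l n) (hmn : Nat.Coprime m n)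
    (T : Fin r → H × H × H)
    (hgen : ∀ j, IsGenTriple (T j))
    (htype : ∀ j, orderOf (T j).1 = l ∧ orderOf (T j).2.1 = m ∧ orderOf (T j).2.2 = n)
    (hineq : ∀ j j', j ≠ j' → ¬ EquivTriple (T j) (T j'))
    (k : ℕ) (hk1 : 2 ≤ k) (hk2 : k ≤ 6 * r) :
    IsBeauvilleGroup (Fin k → H) := by
  let L : Fin 3 → ℕ := ![l, m, n]
  let t (j : Fin r) : Fin 3 → H := ![(T j).1, (T j).2.1, (T j).2.2]
  have hcop : Pairwise fun u v ↦ (L u).Coprime (L v) := by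
    intro u v huv
    fin_cases u <;> fin_cases v <;> first
      | exact absurd rfl huv
      | simpa [L] using ‹_›
      | simpa [L, Nat.coprime_comm] using ‹_›
  have hgen' (j : Fin r) : IsGenerating (t j) :=
    ⟨(hgen j).1, by rw [range_fin_three]; exact (hgen j).2⟩
  have htype' (j : Fin r) (v : Fin 3) : orderOf (t j v) = L v := by
    obtain ⟨h1, h2, h3⟩ := htype j
    fin_cases v <;> assumption
  have hineq' (j j' : Fin r) (hj : j ≠ j') : ¬ ∃ φ : H ≃* H, ∀ v, φ (t j v) = t j' v :=
    fun ⟨φ, hφ⟩ ↦ hineq j j' hj ⟨φ, hφ 0, hφ 1, hφ 2⟩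
  have hL2 (v : Fin 3) : 2 ≤ L v := by
    have hpos := orderOf_pos (t ⟨0, by omega⟩ v)
    have hne := mt orderOf_eq_one_iff.1 ((hgen' ⟨0, by omega⟩).ne_one hnonab v)
    rw [htype'] at hpos hne
    omega
  have hL : Function.Injective L := by
    intro u v huv
    by_contra hne
    have h := hcop hne
    have h2 := hL2 v
    simp only [huv, Nat.coprime_self] at h
    omega
  have hsum : ∑ v, 1 / (L v : ℚ) < 1 := (sum_one_div_lt_one_or hcop hL2).resolve_right
    (not_exists_icosahedral_type hr hnonab hL hgen' htype' hineq')
  obtain ⟨σ, τ, hσ, hτ, hστ⟩ := exists_perm_assignments hr hk1 hk2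
  have : Nonempty (Fin k) := ⟨⟨0, by omega⟩⟩
  let U (ρ : Fin k → Equiv.Perm (Fin 3) × Fin r) (v : Fin 3) (i : Fin k) : H :=
    rearrange (ρ i).1 (t (ρ i).2) v
  have hU (ρ : Fin k → Equiv.Perm (Fin 3) × Fin r) (v : Fin 3) (i : Fin k) :
      orderOf (U ρ v i) = L ((ρ i).1 v) := by rw [orderOf_rearrange, htype']
  exact isBeauvilleGroup_of_isGenerating (U := U σ) (U' := U τ)
    (isGenerating_pi hnonab hL hgen' htype' hineq' hσ)
    (isGenerating_pi hnonab hL hgen' htype' hineq' hτ)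
    (sum_one_div_orderOf_pi_lt_one hsum htype' σ) (sum_one_div_orderOf_pi_lt_one hsum htype' τ)
    fun g hg hg' ↦ eq_one_of_mem_sigmaSet_inter (σ := fun i ↦ (σ i).1) (τ := fun i ↦ (τ i).1)
      hcop (hU σ) (hU τ) hστ hg hg'
end

section
/- Let H be a transitive permutation group on a finite set Ω with |Ω| = n, and suppose H contains an m-cycle. If m is coprime to n and 2m > n, then H is primitive. -/
/-- A subgroup `H` of the symmetric group on `Ω` is primitive if its natural action on `Ω`
is transitive and every block of the action is a singleton-or-empty set or all of `Ω`. -/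
def IsPrimitiveSubgroup {Ω : Type*} (H : Subgroup (Equiv.Perm Ω)) : Prop :=
  MulAction.IsPretransitive H Ω ∧
  ∀ B : Set Ω, MulAction.IsBlock H B → B.Subsingleton ∨ B = Set.univ

open scoped Pointwise in
theorem Equiv.Perm.IsCycle.setOf_ne_subset_of_isBlock {Ω : Type*} {g : Equiv.Perm Ω}
    (hg : g.IsCycle) {B : Set Ω} (hB : MulAction.IsBlock (Subgroup.zpowers g) B) {x y : Ω}
    (hxB : x ∈ B) (hx : g x ≠ x) (hyB : y ∈ B) (hy : g y = y) : {z | g z ≠ z} ⊆ B := by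
  intro z hz
  obtain ⟨i, rfl⟩ := hg.exists_zpow_eq hx hz
  have hfix : (⟨g ^ i, i, rfl⟩ : Subgroup.zpowers g) • B = B :=
    MulAction.isBlock_iff_smul_eq_of_mem.mp hB hyB <| by
      change (g ^ i) y ∈ B
      rwa [Equiv.Perm.zpow_apply_eq_self_of_apply_eq_self hy]
  rw [← hfix]
  exact Set.smul_mem_smul_set hxB

theorem Equiv.Perm.IsCycle.ncard_dvd_card_support_of_isBlock {Ω : Type*} [Fintype Ω]
    [DecidableEq Ω] {g : Equiv.Perm Ω} (hg : g.IsCycle) {B : Set Ω}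
    (hB : MulAction.IsBlock (Subgroup.zpowers g) B) (hne : B.Nonempty)
    (hsub : B ⊆ g.support) : B.ncard ∣ g.support.card := by
  let C : SubMulAction (Subgroup.zpowers g) Ω :=
    { carrier := g.support
      smul_mem' := by
        rintro ⟨_, i, rfl⟩ x hx
        exact Equiv.Perm.zpow_apply_mem_support.mpr hx }
  have : MulAction.IsPretransitive (Subgroup.zpowers g) C := by
    refine ⟨fun ⟨x, hx⟩ ⟨y, hy⟩ ↦ ?_⟩
    obtain ⟨i, hi⟩ := hg.exists_zpow_eq (Equiv.Perm.mem_support.mp hx)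
      (Equiv.Perm.mem_support.mp hy)
    exact ⟨⟨g ^ i, i, rfl⟩, Subtype.ext hi⟩
  have hrange : B ⊆ Set.range (Subtype.val : C → Ω) := by
    rw [Subtype.range_coe]
    exact hsub
  have hdvd := (hB.subtype_val_preimage (C := C)).ncard_dvd_card (hne.preimage' hrange)
  rw [Set.ncard_preimage_of_injective_subset_range Subtype.val_injective hrange] at hdvd
  have hC : Nat.card C = g.support.card := Nat.card_eq_card_finite_toFinset
    g.support.finite_toSet |>.trans (by simp)
  rwa [hC] at hdvd

open scoped Pointwise in
theorem primitive_of_transitive_with_coprime_cycle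
    {Ω : Type*} [Fintype Ω] [DecidableEq Ω] {n : ℕ} (hn : Fintype.card Ω = n)
    (H : Subgroup (Equiv.Perm Ω)) (htrans : MulAction.IsPretransitive H Ω)
    (m : ℕ) (hcop : Nat.Coprime m n) (hm : n < 2 * m)
    (g : Equiv.Perm Ω) (hgH : g ∈ H) (hcyc : g.IsCycle) (hsupp : g.support.card = m) :
    IsPrimitiveSubgroup H := by
  subst hn hsupp
  refine ⟨htrans, fun B hB ↦ ?_⟩
  rcases B.eq_empty_or_nonempty with rfl | ⟨b, hb⟩
  · exact Or.inl Set.subsingleton_empty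
  obtain ⟨x, hx, -⟩ := id hcyc
  obtain ⟨h, rfl⟩ := MulAction.exists_smul_eq H b x
  have hB' : MulAction.IsBlock H (h • B) := hB.translate h
  have hmem : h • b ∈ h • B := Set.smul_mem_smul_set hb
  have hBg : MulAction.IsBlock (Subgroup.zpowers g) (h • B) := by
    refine MulAction.isBlock_iff_smul_eq_or_disjoint.mpr fun k ↦ ?_
    exact MulAction.isBlock_iff_smul_eq_or_disjoint.mp hB'
      ⟨k, Subgroup.zpowers_le.mpr hgH k.2⟩
  have hcard : (h • B).ncard = B.ncard := Set.ncard_smul_set h B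
  by_cases hfix : ∃ y ∈ h • B, g y = y
  · obtain ⟨y, hyB, hy⟩ := hfix
    have hle := Set.ncard_le_ncard (hcyc.setOf_ne_subset_of_isBlock hBg hmem hx hyB hy)
    rw [← Equiv.Perm.coe_support_eq_set_support, Set.ncard_coe_finset, hcard] at hle
    right
    apply hB.eq_univ_of_card_lt
    rw [Nat.card_eq_fintype_card]
    lia
  · push Not at hfix
    left
    have hdvd := hcyc.ncard_dvd_card_support_of_isBlock hBg ⟨_, hmem⟩
      fun y hy ↦ Finset.mem_coe.mpr (Equiv.Perm.mem_support.mpr (hfix y hy))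
    rw [hcard] at hdvd
    have hdvd' := hB.ncard_dvd_card ⟨b, hb⟩
    rw [Nat.card_eq_fintype_card] at hdvd'
    rw [← Set.ncard_le_one_iff_subsingleton]
    exact (Nat.eq_one_of_dvd_coprimes hcop hdvd hdvd').le
end

section
/- Let H be a transitive permutation group on a finite set Ω with |Ω| = n. Suppose H contains an element h that is a product of two disjoint cycles of lengths c and d, where c, d > 1 are coprime integers with c + d = n (so h has no fixed points). Then H contains the alternating group Alt(Ω). -/
/-- The elements of `G` that fix the complement of `A` pointwise act transitively on `A`. -/
def IsTransitiveOn (G : Type*) {X : Type*} [Group G] [MulAction G X] (A : Set X) : Prop :=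
  ∀ x ∈ A, ∀ y ∈ A, ∃ g : G, (∀ z ∉ A, g • z = z) ∧ g • x = y

namespace IsTransitiveOn

open MulAction Pointwise

variable {G X : Type*} [Group G] [MulAction G X] {A : Set X}

theorem isPretransitive (hA : IsTransitiveOn G A) :
    IsPretransitive (fixingSubgroup G Aᶜ) (SubMulAction.ofFixingSubgroup G Aᶜ) where
  exists_smul_eq := by
    rintro ⟨x, hx⟩ ⟨y, hy⟩
    obtain ⟨g, hg, hxy⟩ := hA x (not_not.mp hx) y (not_not.mp hy)
    exact ⟨⟨g, (mem_fixingSubgroup_iff G).mpr hg⟩, Subtype.ext hxy⟩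

theorem smul (hA : IsTransitiveOn G A) (a : G) : IsTransitiveOn G (a • A) := by
  intro x hx y hy
  rw [Set.mem_smul_set_iff_inv_smul_mem] at hx hy
  obtain ⟨g, hg, hxy⟩ := hA _ hx _ hy
  refine ⟨a * g * a⁻¹, fun z hz ↦ ?_, ?_⟩
  · rw [Set.mem_smul_set_iff_inv_smul_mem] at hz
    rw [mul_smul, mul_smul, hg _ hz, smul_inv_smul]
  · rw [mul_smul, mul_smul, hxy, smul_inv_smul]

theorem preimage_ofStabilizer (hA : IsTransitiveOn G A) {a : X} (ha : a ∉ A) :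
    IsTransitiveOn (stabilizer G a)
      (Subtype.val ⁻¹' A : Set (SubMulAction.ofStabilizer G a)) := by
  rintro ⟨x, _⟩ hx ⟨y, _⟩ hy
  obtain ⟨g, hg, hxy⟩ := hA x hx y hy
  exact ⟨⟨g, hg a ha⟩, fun z hz ↦ Subtype.ext (hg z hz), Subtype.ext hxy⟩

/-- Transitivity on a proper subset passes to point stabilizers, up to translating the subset. -/
theorem exists_ofStabilizer [IsPretransitive G X] (hA : IsTransitiveOn G A)
    (hAne : A ≠ Set.univ) (a : X) :
    ∃ A' : Set (SubMulAction.ofStabilizer G a),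
      IsTransitiveOn (stabilizer G a) A' ∧ A'.ncard = A.ncard := by
  obtain ⟨b, hb⟩ := (Set.ne_univ_iff_exists_notMem A).mp hAne
  obtain ⟨g, rfl⟩ := exists_smul_eq G b a
  have ha : g • b ∉ g • A := by rwa [Set.smul_mem_smul_set_iff]
  refine ⟨_, (hA.smul g).preimage_ofStabilizer ha, ?_⟩
  rw [Set.ncard_preimage_of_injective_subset_range Subtype.val_injective, Set.ncard_smul_set]
  intro x hx
  exact ⟨⟨x, fun h ↦ ha (by rwa [← Set.mem_singleton_iff.mp h])⟩, rfl⟩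

theorem ncard_block_dvd_or_le [Finite X] [IsPretransitive G X] (hA : IsTransitiveOn G A)
    {B : Set X} (hB : IsBlock G B) (hBne : B.Nonempty) :
    B.ncard ∣ A.ncard ∨ A.ncard ≤ B.ncard := by
  rcases A.eq_empty_or_nonempty with rfl | ⟨a, ha⟩
  · simp
  obtain ⟨b, hb⟩ := hBne
  obtain ⟨g, rfl⟩ := exists_smul_eq G b a
  have hgb : g • b ∈ g • B := Set.smul_mem_smul_set hb
  have hgB := hB.translate g
  rw [← Set.ncard_smul_set g B]
  by_cases hsub : g • B ⊆ A
  · left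
    have := hA.isPretransitive
    have hblock : IsBlock (fixingSubgroup G Aᶜ)
        (Subtype.val ⁻¹' (g • B) : Set (SubMulAction.ofFixingSubgroup G Aᶜ)) :=
      (hgB.subgroup (H := fixingSubgroup G Aᶜ)).subtype_val_preimage
    have hdvd := hblock.ncard_dvd_card ⟨⟨g • b, not_not.mpr ha⟩, hgb⟩
    have hpre : (Subtype.val ⁻¹' (g • B) : Set (SubMulAction.ofFixingSubgroup G Aᶜ)).ncard =
        (g • B).ncard :=
      Set.ncard_preimage_of_injective_subset_range Subtype.val_injective
        (fun x hx ↦ ⟨⟨x, not_not.mpr (hsub hx)⟩, rfl⟩)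
    have hcard : Nat.card (SubMulAction.ofFixingSubgroup G Aᶜ) = A.ncard :=
      congrArg Set.ncard (compl_compl A)
    rwa [hpre, hcard] at hdvd
  · right
    obtain ⟨z, hz, hzA⟩ := Set.not_subset.mp hsub
    refine Set.ncard_le_ncard fun y hy ↦ ?_
    obtain ⟨k, hk, rfl⟩ := hA _ ha _ hy
    rw [← isBlock_iff_smul_eq_of_mem.mp hgB hz (by rwa [hk z hzA] : k • z ∈ g • B)]
    exact Set.smul_mem_smul_set hgb

end IsTransitiveOn

section

open MulAction

variable {G X : Type*} [Group G] [MulAction G X]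

theorem isPreprimitive_of_isTransitiveOn [Finite X] [IsPretransitive G X] {A B : Set X} {m : ℕ}
    (hA : IsTransitiveOn G A) (hB : IsTransitiveOn G B)
    (hcop : A.ncard.Coprime B.ncard) (hlt : A.ncard < B.ncard)
    (hm : 0 < m) (hmA : m ≤ A.ncard) (hX : Nat.card X = B.ncard + m) :
    IsPreprimitive G X := by
  refine ⟨fun {S} hS ↦ ?_⟩
  rcases S.eq_empty_or_nonempty with rfl | hne
  · exact Or.inl Set.subsingleton_empty
  have hpos : 0 < S.ncard := (Set.ncard_pos).mpr hne
  obtain ⟨q, hq⟩ := hS.ncard_dvd_card hne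
  rcases Nat.lt_or_ge q 2 with hq2 | hq2
  · right
    refine Set.eq_univ_of_univ_subset (Set.eq_of_subset_of_ncard_le (Set.subset_univ S) ?_).ge
    rw [Set.ncard_univ, hq]
    nlinarith
  · left
    have hle : 2 * S.ncard ≤ Nat.card X := by rw [hq]; nlinarith
    have h1 : S.ncard ∣ B.ncard :=
      (hB.ncard_block_dvd_or_le hS hne).resolve_right (by omega)
    have h2 : S.ncard ∣ m := (Nat.dvd_add_right h1).mp (hX ▸ ⟨q, hq⟩)
    have h3 : S.ncard ∣ A.ncard := by
      rcases hA.ncard_block_dvd_or_le hS hne with h | h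
      · exact h
      · have := Nat.le_of_dvd hm h2
        rw [show A.ncard = S.ncard by omega]
    have h4 : S.ncard = 1 := Nat.dvd_one.mp (hcop ▸ Nat.dvd_gcd h3 h1)
    exact (Set.ncard_le_one_iff_subsingleton).mp h4.le

theorem isMultiplyPretransitive_of_isTransitiveOn [Finite X] [IsPretransitive G X] {A B : Set X}
    {m : ℕ} (hA : IsTransitiveOn G A) (hB : IsTransitiveOn G B)
    (hcop : A.ncard.Coprime B.ncard) (hlt : A.ncard < B.ncard)
    (hm : 0 < m) (hmA : m ≤ A.ncard) (hX : Nat.card X = B.ncard + m) :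
    IsMultiplyPretransitive G X m := by
  induction m, hm using Nat.le_induction generalizing G X with
  | base => exact is_one_pretransitive_iff.mpr inferInstance
  | succ m hm ih =>
    have hprim := isPreprimitive_of_isTransitiveOn hA hB hcop hlt (Nat.succ_pos m) hmA hX
    have hcompl := Set.ncard_add_ncard_compl A
    have h2 : IsMultiplyPretransitive G X 2 :=
      hprim.is_two_pretransitive (s := Aᶜ) (n := Aᶜ.ncard - 1) (by omega) (by omega)
        hA.isPretransitive
    have : Nonempty X := (Nat.card_pos_iff.mp (by omega)).1
    obtain ⟨a⟩ := this
    have : IsPretransitive (stabilizer G a) (SubMulAction.ofStabilizer G a) :=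
      is_one_pretransitive_iff.mp (SubMulAction.ofStabilizer.isMultiplyPretransitive.mp h2)
    have hne {C : Set X} (hC : C.ncard < Nat.card X) : C ≠ Set.univ := by
      rintro rfl
      simp at hC
    obtain ⟨A', hA', hcA⟩ := hA.exists_ofStabilizer (hne (by omega)) a
    obtain ⟨B', hB', hcB⟩ := hB.exists_ofStabilizer (hne (by omega)) a
    refine SubMulAction.ofStabilizer.isMultiplyPretransitive.mpr
      (ih hA' hB' (by rwa [hcA, hcB]) (by omega) (by omega) ?_)
    have := SubMulAction.nat_card_ofStabilizer_add_one_eq G a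
    omega

end

namespace Equiv.Perm

variable {Ω : Type*} [Fintype Ω] [DecidableEq Ω]

theorem isThreeCycle_commutator_of_support_inter_eq_singleton {z w : Perm Ω} {x : Ω}
    (h : z.support ∩ w.support = {x}) : (z * w * z⁻¹ * w⁻¹).IsThreeCycle := by
  have key (y : Ω) : z y ≠ y ∧ w y ≠ y ↔ y = x := by
    simpa using Finset.ext_iff.mp h y
  have hx := (key x).mpr rfl
  have hz {a b : Ω} : z a = z b ↔ a = b := z.injective.eq_iff
  have hw {a b : Ω} : w a = w b ↔ a = b := w.injective.eq_iff
  have hwzx : w (z x) = z x := by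
    by_contra hne
    exact hx.1 ((key (z x)).mp ⟨fun h ↦ hx.1 (hz.mp h), hne⟩)
  have hzwx : z (w x) = w x := by
    by_contra hne
    exact hx.2 ((key (w x)).mp ⟨hne, fun h ↦ hx.2 (hw.mp h)⟩)
  have hzw : z x ≠ w x := fun heq ↦ hx.1 (hz.mp (by rw [heq, hzwx]))
  have : z * w * z⁻¹ * w⁻¹ = swap x (w x) * swap x (z x) := by
    rw [mul_inv_eq_iff_eq_mul, mul_inv_eq_iff_eq_mul]
    ext y
    simp only [mul_apply]
    by_cases hyx : y = x
    · subst hyx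
      rw [hzwx, hwzx, swap_apply_right, swap_apply_left]
    by_cases hzy : z y = y
    · have hzwy : w y = x ∨ z (w y) = w y := by grind
      rw [hzy]
      rcases hzwy with h | h
      · rw [h, swap_apply_left, swap_apply_of_ne_of_ne hx.1 hzw]
      · rw [h, swap_apply_of_ne_of_ne (a := x) (b := z x),
          swap_apply_of_ne_of_ne] <;> grind
    · have hwy : w y = y := by grind
      rw [hwy]
      rcases eq_or_ne (z y) x with h | h
      · rw [h, swap_apply_of_ne_of_ne hx.2 hzw.symm, swap_apply_right]
      · have hwzy : w (z y) = z y := by grind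
        rw [hwzy, swap_apply_of_ne_of_ne h (by grind), swap_apply_of_ne_of_ne h (by grind)]
  rw [this]
  exact isThreeCycle_swap_mul_swap_same hx.2.symm hx.1.symm hzw.symm

theorem IsCycle.isTransitiveOn {H : Subgroup (Perm Ω)} {z : Perm Ω} (hz : z.IsCycle)
    (hzH : z ∈ H) : IsTransitiveOn H (z.support : Set Ω) := by
  intro x hx y hy
  obtain ⟨i, hi⟩ := hz.sameCycle (by simpa using hx) (by simpa using hy)
  refine ⟨⟨z ^ i, H.zpow_mem hzH i⟩, fun y hy ↦ ?_, hi⟩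
  exact zpow_apply_eq_self_of_apply_eq_self (by simpa using hy) i

theorem IsCycle.mem_of_mul_mem {H : Subgroup (Perm Ω)} {σ τ : Perm Ω} (hσ : σ.IsCycle)
    (hτ : τ.IsCycle) (hdisj : σ.Disjoint τ)
    (hcop : σ.support.card.Coprime τ.support.card) (h : σ * τ ∈ H) : σ ∈ H := by
  have hpow : σ ^ τ.support.card ∈ H := by
    have := H.pow_mem h τ.support.card
    rwa [hdisj.commute.mul_pow, ← hτ.orderOf, pow_orderOf_eq_one, mul_one, hτ.orderOf] at this
  obtain ⟨k, hk⟩ := exists_pow_eq_self_of_coprime (x := σ) (n := τ.support.card)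
    (by rw [hσ.orderOf]; exact hcop.symm)
  exact hk ▸ H.pow_mem hpow k

theorem alternatingGroup_le_of_isMultiplyPretransitive {H : Subgroup (Perm Ω)} {z : Perm Ω}
    (hz : z ∈ H) (hz1 : 1 < z.support.card) (hcard : 2 * z.support.card ≤ Fintype.card Ω + 1)
    (htrans : MulAction.IsMultiplyPretransitive H Ω z.support.card) :
    alternatingGroup Ω ≤ H := by
  have : MulAction.IsMultiplyPretransitive H Ω 2 :=
    MulAction.isMultiplyPretransitive_of_le hz1 (by
      rw [Nat.card_eq_fintype_card]; exact Finset.card_le_univ _)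
  obtain ⟨x, hx⟩ := Finset.card_pos.mp (zero_lt_one.trans hz1)
  obtain ⟨T, hxT, hTcard, hT⟩ : ∃ T : Finset Ω, x ∈ T ∧ T.card = z.support.card ∧
      z.support ∩ T = {x} := by
    obtain ⟨U, hU, hUc⟩ := Finset.exists_subset_card_eq
      (s := z.supportᶜ) (n := z.support.card - 1) (by rw [Finset.card_compl]; omega)
    have hxU : x ∉ U := fun h ↦ Finset.mem_compl.mp (hU h) hx
    refine ⟨insert x U, Finset.mem_insert_self _ _, ?_, ?_⟩
    · rw [Finset.card_insert_of_notMem hxU]; omega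
    · ext y
      have := @hU y
      simp only [Finset.mem_compl] at this
      grind
  let e := z.support.equivFin
  let f := T.equivFinOfCardEq hTcard
  obtain ⟨g, hg⟩ := htrans.exists_smul_eq
    (e.symm.toEmbedding.trans (Function.Embedding.subtype _))
    (f.symm.toEmbedding.trans (Function.Embedding.subtype _))
  have hgT : z.support.map (g : Perm Ω).toEmbedding = T := by
    refine Finset.eq_of_subset_of_card_le (fun y hy ↦ ?_) (by simp [hTcard])
    obtain ⟨w, hw, rfl⟩ := Finset.mem_map.mp hy
    have := DFunLike.congr_fun hg (e ⟨w, hw⟩)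
    have h' : (g : Perm Ω) w = f.symm (e ⟨w, hw⟩) := by
      simpa [Subgroup.smul_def] using this
    simp [h']
  have h3 : (z * (g * z * (g : Perm Ω)⁻¹) * z⁻¹ * (g * z * (g : Perm Ω)⁻¹)⁻¹).IsThreeCycle :=
    isThreeCycle_commutator_of_support_inter_eq_singleton (x := x)
      (by rw [support_conj, hgT, hT])
  have hw : g * z * (g : Perm Ω)⁻¹ ∈ H := H.mul_mem (H.mul_mem g.2 hz) (H.inv_mem g.2)
  exact alternatingGroup_le_of_isPreprimitive_of_isThreeCycle_mem
    (MulAction.isPreprimitive_of_is_two_pretransitive this) h3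
    (H.mul_mem (H.mul_mem (H.mul_mem hz hw) (H.inv_mem hz)) (H.inv_mem hw))

end Equiv.Perm

theorem alternating_le_of_two_coprime_cycles
    {Ω : Type*} [Fintype Ω] [DecidableEq Ω] {n : ℕ} (hn : Fintype.card Ω = n)
    (H : Subgroup (Equiv.Perm Ω)) (htrans : MulAction.IsPretransitive H Ω)
    (c d : ℕ) (hc : 1 < c) (hd : 1 < d) (hcop : Nat.Coprime c d) (hcd : c + d = n)
    (h σ τ : Equiv.Perm Ω) (hH : h ∈ H) (hστ : h = σ * τ)
    (hσ : σ.IsCycle) (hτ : τ.IsCycle) (hdisj : σ.Disjoint τ)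
    (hσc : σ.support.card = c) (hτd : τ.support.card = d) :
    alternatingGroup Ω ≤ H := by
  subst hσc hτd hστ
  wlog hlt : σ.support.card < τ.support.card generalizing σ τ
  · have hne : σ.support.card ≠ τ.support.card := fun heq ↦ by
      rw [heq, Nat.coprime_self] at hcop
      omega
    exact this τ σ hτ hσ hdisj.symm hd hc hcop.symm (by omega)
      (hdisj.commute.eq ▸ hH) (by omega)
  have hσH := hσ.mem_of_mul_mem hτ hdisj hcop hH
  have hτH := hτ.mem_of_mul_mem hσ hdisj.symm hcop.symm (hdisj.commute.eq ▸ hH)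
  refine Equiv.Perm.alternatingGroup_le_of_isMultiplyPretransitive hσH hc (by omega) ?_
  refine isMultiplyPretransitive_of_isTransitiveOn (hσ.isTransitiveOn hσH)
    (hτ.isTransitiveOn hτH) ?_ ?_ (by omega) ?_ ?_ <;>
  simp only [Set.ncard_coe_finset, Nat.card_eq_fintype_card] <;> first | assumption | omega
end

section
/- Let H be a transitive permutation group on a finite set Ω with |Ω| = n. Suppose H contains an element h that fixes exactly one point and is a product of two disjoint cycles of lengths c and d, where c, d > 1 are coprime integers with 1 + c + d = n, and suppose that neither 1 + c nor 1 + d divides n. Then H contains the alternating group Alt(Ω). -/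
open scoped Pointwise

namespace MulAction

section JordanSet

variable {G : Type*} [Group G] {α : Type*} [MulAction G α]

/-- A set `D` is a Jordan set for an action of `G` if the pointwise stabilizer of its complement
is transitive on `D`. -/
def IsJordanSet (G : Type*) [Group G] {α : Type*} [MulAction G α] (D : Set α) : Prop :=
  ∀ x ∈ D, ∀ y ∈ D, ∃ g : G, g • x = y ∧ ∀ z ∉ D, g • z = z

namespace IsJordanSet

variable {D : Set α}

theorem smul (hD : IsJordanSet G D) (g : G) : IsJordanSet G (g • D) := by
  rintro _ ⟨x, hx, rfl⟩ _ ⟨y, hy, rfl⟩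
  obtain ⟨k, hk, hk'⟩ := hD x hx y hy
  refine ⟨g * k * g⁻¹, by simp [mul_smul, hk], fun z hz ↦ ?_⟩
  rw [Set.mem_smul_set_iff_inv_smul_mem] at hz
  rw [mul_smul, mul_smul, hk' _ hz, smul_inv_smul]

theorem preimage_ofStabilizer (hD : IsJordanSet G D) {a : α} (ha : a ∉ D) :
    IsJordanSet (stabilizer G a)
      (Subtype.val ⁻¹' D : Set (SubMulAction.ofStabilizer G a)) := by
  intro x hx y hy
  obtain ⟨g, hg, hg'⟩ := hD x hx y hy
  exact ⟨⟨g, hg' a ha⟩, Subtype.ext hg, fun z hz ↦ Subtype.ext (hg' z hz)⟩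

theorem ncard_preimage_ofStabilizer {a : α} (ha : a ∉ D) :
    (Subtype.val ⁻¹' D : Set (SubMulAction.ofStabilizer G a)).ncard = D.ncard := by
  refine Set.ncard_preimage_of_injective_subset_range Subtype.val_injective fun x hx ↦ ?_
  exact ⟨⟨x, fun h ↦ ha (h ▸ hx)⟩, rfl⟩

/-- A point stabilizer of a transitive action inherits Jordan sets up to translation. -/
theorem exists_ofStabilizer [IsPretransitive G α] (hD : IsJordanSet G D) (hne : D ≠ Set.univ)
    (a : α) : ∃ E : Set (SubMulAction.ofStabilizer G a),
      IsJordanSet (stabilizer G a) E ∧ E.ncard = D.ncard := by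
  obtain ⟨b, hb⟩ := (Set.ne_univ_iff_exists_notMem D).mp hne
  obtain ⟨g, rfl⟩ := exists_smul_eq G b a
  have hg : g • b ∉ g • D := by simpa using hb
  exact ⟨_, (hD.smul g).preimage_ofStabilizer hg,
    (ncard_preimage_ofStabilizer hg).trans (Set.ncard_smul_set g D)⟩

theorem isPretransitive (hD : IsJordanSet G D) :
    IsPretransitive (fixingSubgroup G Dᶜ) (SubMulAction.ofFixingSubgroup G Dᶜ) := by
  refine ⟨fun x y ↦ ?_⟩
  obtain ⟨g, hg, hg'⟩ := hD x (not_not.mp x.2) y (not_not.mp y.2)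
  exact ⟨⟨g, fun z ↦ hg' z z.2⟩, Subtype.ext hg⟩

theorem subset_of_isBlock (hD : IsJordanSet G D) {B : Set α} (hB : IsBlock G B) {x y : α}
    (hx : x ∈ B) (hxD : x ∉ D) (hy : y ∈ B) (hyD : y ∈ D) : D ⊆ B := by
  intro z hz
  obtain ⟨g, rfl, hg⟩ := hD y hyD z hz
  rw [← hB.smul_eq_of_mem hx (by rwa [hg x hxD])]
  exact Set.smul_mem_smul_set hy

theorem ncard_dvd_of_isBlock (hD : IsJordanSet G D) {B : Set α} (hB : IsBlock G B)
    (hne : B.Nonempty) (hBD : B ⊆ D) : B.ncard ∣ D.ncard := by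
  have := hD.isPretransitive
  let B' : Set (SubMulAction.ofFixingSubgroup G Dᶜ) := Subtype.val ⁻¹' B
  have hmem {x : α} (hx : x ∈ D) : x ∈ SubMulAction.ofFixingSubgroup G Dᶜ := by
    simpa [SubMulAction.mem_ofFixingSubgroup_iff] using hx
  have hB' : IsBlock (fixingSubgroup G Dᶜ) B' := by
    rw [isBlock_iff_smul_eq_of_mem]
    intro g a ha hga
    have := hB.smul_eq_of_mem (g := (g : G)) ha hga
    ext z
    rw [Set.mem_smul_set_iff_inv_smul_mem]
    change (g⁻¹ : G) • (z : α) ∈ B ↔ (z : α) ∈ B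
    rw [← Set.mem_smul_set_iff_inv_smul_mem, this]
  have hcard : B'.ncard = B.ncard :=
    Set.ncard_preimage_of_injective_subset_range Subtype.val_injective
      fun x hx ↦ ⟨⟨x, hmem (hBD hx)⟩, rfl⟩
  obtain ⟨x, hx⟩ := hne
  rw [← hcard]
  convert hB'.ncard_dvd_card ⟨⟨x, hmem (hBD hx)⟩, hx⟩
  rw [← Nat.card_coe_set_eq]
  exact Nat.card_congr (Equiv.subtypeEquivRight fun x ↦ by
    simp [SubMulAction.mem_ofFixingSubgroup_iff])

theorem ncard_le_or_dvd_of_isBlock [Finite α] [IsPretransitive G α] (hD : IsJordanSet G D)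
    (hDne : D.Nonempty) {B : Set α} (hB : IsBlock G B) (hne : B.Nonempty) :
    D.ncard ≤ B.ncard ∨ B.ncard ∣ D.ncard := by
  obtain ⟨y, hy⟩ := hDne
  obtain ⟨b, hb⟩ := hne
  obtain ⟨g, rfl⟩ := exists_smul_eq G b y
  rw [← Set.ncard_smul_set g B]
  by_cases h : g • B ⊆ D
  · exact .inr (hD.ncard_dvd_of_isBlock (hB.translate g) ⟨_, Set.smul_mem_smul_set hb⟩ h)
  · obtain ⟨x, hx, hxD⟩ := Set.not_subset.mp h
    exact .inl (Set.ncard_le_ncard (hD.subset_of_isBlock (hB.translate g) hx hxD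
      (Set.smul_mem_smul_set hb) hy) (Set.toFinite _))

theorem isMultiplyPretransitive_two [Finite α] (hG : IsPreprimitive G α) (hD : IsJordanSet G D)
    (hD1 : 1 < D.ncard) (hDα : D ≠ Set.univ) : IsMultiplyPretransitive G α 2 := by
  have h1 := Set.ncard_add_ncard_compl D
  have h2 : 0 < Dᶜ.ncard := by
    rw [Set.ncard_pos]
    exact Set.nonempty_compl.mpr hDα
  exact hG.is_two_pretransitive (s := Dᶜ) (n := Dᶜ.ncard - 1) (by omega) (by omega)
    hD.isPretransitive

variable {C : Set α}

theorem isPreprimitive_of_coprime [Finite α] [IsPretransitive G α]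
    (hC : IsJordanSet G C) (hD : IsJordanSet G D) (hD1 : 1 < D.ncard) (hDC : D.ncard < C.ncard)
    (hcop : C.ncard.Coprime D.ncard) (hlt : C.ncard < Nat.card α)
    (hle : Nat.card α ≤ C.ncard + D.ncard) : IsPreprimitive G α where
  isTrivialBlock_of_isBlock {B} hB := by
    rw [IsTrivialBlock, or_iff_not_imp_left, Set.not_subsingleton_iff]
    intro hBnt
    by_contra hBuniv
    have hB1 : 1 < B.ncard := (Set.one_lt_ncard_iff_nontrivial).mpr hBnt
    have hB2 : B.ncard * 2 ≤ Nat.card α := not_lt.mp fun h ↦ hBuniv (hB.eq_univ_of_card_lt h)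
    have hBC : B.ncard ∣ C.ncard := (hC.ncard_le_or_dvd_of_isBlock
      (Set.nonempty_of_ncard_ne_zero (by omega)) hB hBnt.nonempty).resolve_left (by omega)
    have hBD : B.ncard ∣ D.ncard := by
      refine (hD.ncard_le_or_dvd_of_isBlock
        (Set.nonempty_of_ncard_ne_zero (by omega)) hB hBnt.nonempty).elim (fun h ↦ ?_) id
      have hdvd := Nat.dvd_sub (hB.ncard_dvd_card hBnt.nonempty) hBC
      have := Nat.le_of_dvd (by omega) hdvd
      rwa [show Nat.card α - C.ncard = D.ncard by omega] at hdvd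
    have := Nat.dvd_gcd hBC hBD
    rw [hcop, Nat.dvd_one] at this
    omega

end IsJordanSet

theorem isMultiplyPretransitive_of_isJordanSet_of_coprime {c d : ℕ} (hd : 1 < d) (hdc : d < c)
    (hcop : c.Coprime d) (k : ℕ) (hk : k < d) {G : Type*} [Group G] {α : Type*} [MulAction G α]
    [Finite α] [IsPretransitive G α] {C D : Set α} (hC : IsJordanSet G C) (hD : IsJordanSet G D)
    (hCc : C.ncard = c) (hDd : D.ncard = d) (hα : Nat.card α = c + 1 + k) :
    IsMultiplyPretransitive G α (k + 2) := by
  induction k generalizing G α with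
  | zero =>
    have hprim : IsPreprimitive G α := hC.isPreprimitive_of_coprime hD (by omega) (by omega)
      (by rwa [hCc, hDd]) (by omega) (by omega)
    refine hD.isMultiplyPretransitive_two hprim (by omega) ?_
    rintro rfl
    rw [Set.ncard_univ] at hDd
    omega
  | succ k ih =>
    have hne {E : Set α} (hE : E.ncard ≤ c) : E ≠ Set.univ := by
      rintro rfl
      rw [Set.ncard_univ] at hE
      omega
    have hprim : IsPreprimitive G α := hC.isPreprimitive_of_coprime hD (by omega) (by omega)
      (by rwa [hCc, hDd]) (by omega) (by omega)
    have h2 := hD.isMultiplyPretransitive_two hprim (by omega) (hne (by omega))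
    obtain ⟨a⟩ : Nonempty α := (Nat.card_pos_iff.mp (by omega)).1
    obtain ⟨C', hC', hCc'⟩ := hC.exists_ofStabilizer (hne (by omega)) a
    obtain ⟨D', hD', hDd'⟩ := hD.exists_ofStabilizer (hne (by omega)) a
    rw [SubMulAction.ofStabilizer.isMultiplyPretransitive (a := a)] at h2 ⊢
    rw [is_one_pretransitive_iff] at h2
    have hcard := SubMulAction.nat_card_ofStabilizer_add_one_eq G a
    exact ih (by omega) hC' hD' (by omega) (by omega) (by omega)

/-- If the complement of a fixed point is the disjoint union of two Jordan sets whose sizes are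
compatible with no nontrivial block, then the action is primitive. -/
theorem isPreprimitive_of_isJordanSet_of_not_dvd {G : Type*} [Group G] {α : Type*}
    [MulAction G α] [Finite α] [IsPretransitive G α] {C D : Set α} (hC : IsJordanSet G C)
    (hD : IsJordanSet G D) {p : α} (hpC : p ∉ C) (hpD : p ∉ D)
    (hcover : ∀ x, x = p ∨ x ∈ C ∨ x ∈ D) (hC1 : ¬ 1 + C.ncard ∣ Nat.card α)
    (hD1 : ¬ 1 + D.ncard ∣ Nat.card α) : IsPreprimitive G α := by
  refine IsPreprimitive.of_isTrivialBlock_base p fun {B} hpB hB ↦ ?_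
  have key {E F : Set α} (hE : IsJordanSet G E) (hpE : p ∉ E)
      (hc : ∀ x, x = p ∨ x ∈ E ∨ x ∈ F) (hEd : ¬ 1 + E.ncard ∣ Nat.card α)
      (hmeet : ∃ y ∈ B, y ∈ E) : ∃ y ∈ B, y ∈ F := by
    obtain ⟨y, hyB, hyE⟩ := hmeet
    by_contra! h
    have hBE : B = insert p E := by
      refine subset_antisymm (fun x hx ↦ ?_)
        (Set.insert_subset hpB (hE.subset_of_isBlock hB hpB hpE hyB hyE))
      exact (hc x).imp id fun h' ↦ h'.resolve_right (h x hx)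
    apply hEd
    rw [add_comm, ← Set.ncard_insert_of_notMem hpE, ← hBE]
    exact hB.ncard_dvd_card ⟨p, hpB⟩
  by_cases hmC : ∃ y ∈ B, y ∈ C
  · obtain ⟨y, hyB, hyC⟩ := hmC
    obtain ⟨z, hzB, hzD⟩ := key hC hpC hcover hC1 ⟨y, hyB, hyC⟩
    refine .inr (Set.eq_univ_of_forall fun x ↦ ?_)
    obtain rfl | hx | hx := hcover x
    · exact hpB
    · exact hC.subset_of_isBlock hB hpB hpC hyB hyC hx
    · exact hD.subset_of_isBlock hB hpB hpD hzB hzD hx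
  · have hmD : ¬ ∃ y ∈ B, y ∈ D := fun h ↦
      hmC (key hD hpD (fun x ↦ (hcover x).imp id Or.symm) hD1 h)
    push Not at hmC hmD
    refine .inl (Set.subsingleton_of_forall_eq p fun x hx ↦ ?_)
    exact (hcover x).resolve_right fun h ↦ h.elim (hmC x hx) (hmD x hx)

/-- Two Jordan sets of coprime sizes `1 < d < c`, with `1 + c + d` points in total,
force `d + 2`-fold transitivity of a primitive action. -/
theorem IsPreprimitive.isMultiplyPretransitive_of_isJordanSet_of_coprime {G : Type*} [Group G]
    {α : Type*} [MulAction G α] [Finite α] (hG : IsPreprimitive G α) {C D : Set α}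
    (hC : IsJordanSet G C) (hD : IsJordanSet G D) (hD1 : 1 < D.ncard) (hDC : D.ncard < C.ncard)
    (hcop : C.ncard.Coprime D.ncard) (hα : Nat.card α = 1 + C.ncard + D.ncard) :
    IsMultiplyPretransitive G α (D.ncard + 2) := by
  have hne {E : Set α} (hE : E.ncard ≤ C.ncard) : E ≠ Set.univ := by
    rintro rfl
    rw [Set.ncard_univ] at hE
    omega
  have h2 := hD.isMultiplyPretransitive_two hG hD1 (hne hDC.le)
  obtain ⟨a⟩ : Nonempty α := (Nat.card_pos_iff.mp (by omega)).1
  obtain ⟨C', hC', hCc'⟩ := hC.exists_ofStabilizer (hne le_rfl) a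
  obtain ⟨D', hD', hDd'⟩ := hD.exists_ofStabilizer (hne hDC.le) a
  rw [SubMulAction.ofStabilizer.isMultiplyPretransitive (a := a)] at h2 ⊢
  rw [is_one_pretransitive_iff] at h2
  have hcard := SubMulAction.nat_card_ofStabilizer_add_one_eq G a
  convert! MulAction.isMultiplyPretransitive_of_isJordanSet_of_coprime hD1 hDC hcop (D.ncard - 1)
    (by omega) hC' hD' hCc' hDd' (by omega) using 1
  omega

end JordanSet

end MulAction

namespace Equiv.Perm

open MulAction

theorem Disjoint.left_mem_of_mul_mem {Ω : Type*} {H : Subgroup (Perm Ω)} {σ τ : Perm Ω}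
    (hdisj : σ.Disjoint τ) (hcop : (_root_.orderOf σ).Coprime (_root_.orderOf τ)) (hH : σ * τ ∈ H) :
    σ ∈ H := by
  obtain ⟨k, hk, hk'⟩ := Nat.chineseRemainder hcop 1 0
  have := H.pow_mem hH k
  rwa [hdisj.commute.mul_pow, pow_eq_pow_iff_modEq.mpr hk, pow_eq_pow_iff_modEq.mpr hk', pow_one,
    pow_zero, mul_one] at this

variable {Ω : Type*} [Fintype Ω] [DecidableEq Ω]

theorem IsCycle.isJordanSet_support {H : Subgroup (Perm Ω)} {τ : Perm Ω} (hτ : τ.IsCycle)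
    (hH : τ ∈ H) : IsJordanSet H (τ.support : Set Ω) := by
  intro x hx y hy
  obtain ⟨i, hi⟩ := hτ.exists_zpow_eq (mem_support.mp hx) (mem_support.mp hy)
  exact ⟨⟨τ ^ i, H.zpow_mem hH i⟩, hi,
    fun z hz ↦ zpow_apply_eq_self_of_apply_eq_self (notMem_support.mp hz) i⟩

theorem isThreeCycle_commutator {σ τ : Perm Ω} {a : Ω} (h : σ.support ∩ τ.support = {a}) :
    (σ * τ * σ⁻¹ * τ⁻¹).IsThreeCycle := by
  have hst (x : Ω) (hx : x ≠ a) : σ x = x ∨ τ x = x := by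
    by_contra! hcon
    have : x ∈ σ.support ∩ τ.support := by simpa using hcon
    rw [h, Finset.mem_singleton] at this
    exact hx this
  have ha : a ∈ σ.support ∩ τ.support := by simp [h]
  obtain ⟨hσa, hτa⟩ : σ a ≠ a ∧ τ a ≠ a := by simpa using ha
  have hτσ : τ (σ a) = σ a := (hst _ hσa).resolve_left fun h ↦ hσa (σ.injective h)
  have hστ : σ (τ a) = τ a := (hst _ hτa).resolve_right fun h ↦ hτa (τ.injective h)
  have hne : σ a ≠ τ a := fun h ↦ hτa (τ.injective (by rw [← h, hτσ]))
  convert isThreeCycle_swap_mul_swap_same hτa.symm hσa.symm hne.symm using 1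
  rw [mul_inv_eq_iff_eq_mul, mul_inv_eq_iff_eq_mul]
  ext x
  simp only [mul_apply]
  by_cases hxa : x = a
  · rw [hxa, hστ, hτσ, Equiv.swap_apply_right, Equiv.swap_apply_left]
  obtain hσx | hτx := hst x hxa
  · rw [hσx]
    by_cases hτxa : τ x = a
    · rw [hτxa, Equiv.swap_apply_left, Equiv.swap_apply_of_ne_of_ne hσa hne]
    have hστx : σ (τ x) = τ x :=
      (hst _ hτxa).elim id fun h ↦ by rw [τ.injective h, hσx]
    have hτxσa : τ x ≠ σ a := fun h ↦ hτxa (σ.injective (hστx.trans h))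
    rw [hστx, Equiv.swap_apply_of_ne_of_ne hτxa hτxσa,
      Equiv.swap_apply_of_ne_of_ne hτxa (τ.injective.ne hxa)]
  · rw [hτx]
    by_cases hσxa : σ x = a
    · rw [hσxa, Equiv.swap_apply_of_ne_of_ne hτa hne.symm, Equiv.swap_apply_right]
    have hτσx : τ (σ x) = σ x :=
      (hst _ hσxa).elim (fun h ↦ by rw [σ.injective h, hτx]) id
    have hσxτa : σ x ≠ τ a := fun h ↦ hσxa (τ.injective (hτσx.trans h))
    rw [hτσx, Equiv.swap_apply_of_ne_of_ne hσxa (σ.injective.ne hxa),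
      Equiv.swap_apply_of_ne_of_ne hσxa hσxτa]

/-- A transitive enough group containing a cycle of length `d` contains a three-cycle. -/
theorem IsCycle.exists_isThreeCycle_mem {H : Subgroup (Perm Ω)} {τ : Perm Ω} (hτ : τ.IsCycle)
    (hH : τ ∈ H) (hcard : 2 * τ.support.card ≤ Fintype.card Ω + 1)
    (htrans : IsMultiplyPretransitive H Ω τ.support.card) : ∃ g ∈ H, g.IsThreeCycle := by
  obtain ⟨a, ha, -⟩ := id hτ
  have ha' : a ∈ τ.support := mem_support.mpr ha
  obtain ⟨T, hT, hTc⟩ := Finset.exists_subset_card_eq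
    (s := τ.supportᶜ) (n := τ.support.card - 1) (by rw [Finset.card_compl]; omega)
  have haT : a ∉ T := fun h ↦ Finset.mem_compl.mp (hT h) ha'
  have hTc' : (insert a T).card = τ.support.card := by
    rw [Finset.card_insert_of_notMem haT]
    have := Finset.card_pos.mpr ⟨a, ha'⟩
    omega
  obtain ⟨g, hg⟩ := exists_smul_eq H
    (τ.support.equivFin.symm.toEmbedding.trans (.subtype _))
    (((insert a T).equivFinOfCardEq hTc').symm.toEmbedding.trans (.subtype _))
  have hmap : τ.support.map (g : Perm Ω).toEmbedding = insert a T := by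
    refine Finset.eq_of_subset_of_card_le (fun y hy ↦ ?_) (by rw [Finset.card_map, hTc'])
    obtain ⟨x, hx, rfl⟩ := Finset.mem_map.mp hy
    have := DFunLike.congr_fun hg (τ.support.equivFin ⟨x, hx⟩)
    simp only [Function.Embedding.smul_apply, Function.Embedding.trans_apply,
      Equiv.coe_toEmbedding, Equiv.symm_apply_apply] at this
    change (g : Perm Ω) x = _ at this
    change (g : Perm Ω) x ∈ _
    rw [this]
    exact Subtype.prop _
  refine ⟨_, ?_, isThreeCycle_commutator (σ := τ) (τ := (g : Perm Ω) * τ * (g : Perm Ω)⁻¹) (a := a) ?_⟩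
  · have := H.mul_mem (H.mul_mem g.2 hH) (H.inv_mem g.2)
    exact H.mul_mem (H.mul_mem (H.mul_mem hH this) (H.inv_mem hH)) (H.inv_mem this)
  · rw [support_conj, hmap]
    ext x
    simp only [Finset.mem_inter, Finset.mem_insert, Finset.mem_singleton]
    refine ⟨fun ⟨hx, hx'⟩ ↦ hx'.resolve_right fun h ↦ Finset.mem_compl.mp (hT h) hx, ?_⟩
    rintro rfl
    exact ⟨ha', .inl rfl⟩

theorem alternatingGroup_le_of_isCycle_of_coprime {H : Subgroup (Perm Ω)}
    (hprim : IsPreprimitive H Ω) {σ τ : Perm Ω} (hσ : σ.IsCycle) (hτ : τ.IsCycle)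
    (hσH : σ ∈ H) (hτH : τ ∈ H) (hlt : τ.support.card < σ.support.card)
    (hcop : σ.support.card.Coprime τ.support.card)
    (hcard : Fintype.card Ω = 1 + σ.support.card + τ.support.card) :
    alternatingGroup Ω ≤ H := by
  have hτ2 := hτ.two_le_card_support
  have := hprim.isMultiplyPretransitive_of_isJordanSet_of_coprime
    (hσ.isJordanSet_support hσH) (hτ.isJordanSet_support hτH)
  simp only [Set.ncard_coe_finset, Nat.card_eq_fintype_card] at this
  have := this hτ2 hlt hcop hcard
  obtain ⟨g, hgH, hg⟩ := hτ.exists_isThreeCycle_mem hτH (by omega)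
    (isMultiplyPretransitive_of_le (n := τ.support.card + 2) (by omega)
      (by rw [Nat.card_eq_fintype_card]; omega))
  exact alternatingGroup_le_of_isPreprimitive_of_isThreeCycle_mem hprim hg hgH

end Equiv.Perm

theorem alternating_le_of_two_coprime_cycles_one_fixed_point
    {Ω : Type*} [Fintype Ω] [DecidableEq Ω] {n : ℕ} (hn : Fintype.card Ω = n)
    (H : Subgroup (Equiv.Perm Ω)) (htrans : MulAction.IsPretransitive H Ω)
    (c d : ℕ) (hc : 1 < c) (hd : 1 < d) (hcop : Nat.Coprime c d)
    (hcd : 1 + c + d = n) (hc1 : ¬ (1 + c) ∣ n) (hd1 : ¬ (1 + d) ∣ n)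
    (h σ τ : Equiv.Perm Ω) (hH : h ∈ H) (hστ : h = σ * τ)
    (hσ : σ.IsCycle) (hτ : τ.IsCycle) (hdisj : σ.Disjoint τ)
    (hσc : σ.support.card = c) (hτd : τ.support.card = d) :
    alternatingGroup Ω ≤ H := by
  subst hστ hσc hτd
  have hσH : σ ∈ H := hdisj.left_mem_of_mul_mem (by rwa [hσ.orderOf, hτ.orderOf]) hH
  have hτH : τ ∈ H := hdisj.symm.left_mem_of_mul_mem
    (by rwa [hσ.orderOf, hτ.orderOf, Nat.coprime_comm]) (by rwa [← hdisj.commute.eq])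
  have hcompl : (σ.support ∪ τ.support)ᶜ.card = 1 := by
    rw [Finset.card_compl, Finset.card_union_of_disjoint hdisj.disjoint_support]
    omega
  obtain ⟨p, hp⟩ := Finset.card_eq_one.mp hcompl
  have hcover (x : Ω) : x = p ↔ ¬ (x ∈ σ.support ∨ x ∈ τ.support) := by
    rw [← Finset.mem_singleton, ← hp, Finset.mem_compl, Finset.mem_union]
  have hp' := not_or.mp ((hcover p).mp rfl)
  have hprim : MulAction.IsPreprimitive H Ω :=
    MulAction.isPreprimitive_of_isJordanSet_of_not_dvd
      (hσ.isJordanSet_support hσH) (hτ.isJordanSet_support hτH) hp'.1 hp'.2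
      (fun x ↦ or_iff_not_imp_left.mpr fun hx ↦ not_not.mp ((hcover x).not.mp hx))
      (by rwa [Set.ncard_coe_finset, Nat.card_eq_fintype_card, hn])
      (by rwa [Set.ncard_coe_finset, Nat.card_eq_fintype_card, hn])
  obtain hlt | heq | hlt := lt_trichotomy τ.support.card σ.support.card
  · exact Equiv.Perm.alternatingGroup_le_of_isCycle_of_coprime hprim hσ hτ hσH hτH hlt hcop (by omega)
  · rw [heq, Nat.coprime_self] at hcop
    omega
  · exact Equiv.Perm.alternatingGroup_le_of_isCycle_of_coprime hprim hτ hσ hτH hσH hlt hcop.symm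
      (by omega)
end

section
/- For every k with 2 ≤ k ≤ 19, the direct power (A₅)^k of the alternating group A₅ is a Beauville group. -/
open Equiv Subgroup
open scoped commutatorElement

/-- The product of the word in `a` and `b` in which `true` stands for `a` and `false` for `b`. -/
def evalWord {M : Type*} [Monoid M] (a b : M) (w : List Bool) : M :=
  (w.map fun s => cond s a b).prod

theorem map_evalWord {M N : Type*} [Monoid M] [Monoid N] (f : M →* N) (a b : M)
    (w : List Bool) : f (evalWord a b w) = evalWord (f a) (f b) w := by
  simp only [evalWord, map_list_prod, List.map_map]
  congr 2
  ext s
  cases s <;> rfl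

theorem evalWord_mem {G : Type*} [Group G] {H : Subgroup G} {a b : G} (ha : a ∈ H) (hb : b ∈ H)
    (w : List Bool) : evalWord a b w ∈ H := by
  refine list_prod_mem fun x hx => ?_
  obtain ⟨s, -, rfl⟩ := List.mem_map.1 hx
  cases s
  exacts [hb, ha]

/-- A subgroup of a power of a perfect simple group is everything as soon as it surjects onto each
factor and separates any two coordinates. -/
theorem Subgroup.eq_top_of_separates {ι G : Type*} [Finite ι] [Group G] [IsSimpleGroup G]
    (hG : ⁅(⊤ : Subgroup G), (⊤ : Subgroup G)⁆ = ⊤) (H : Subgroup (ι → G))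
    (surj : ∀ i, H.map (Pi.evalMonoidHom (fun _ => G) i) = ⊤)
    (sep : ∀ i j, i ≠ j → ∃ h ∈ H, h i ≠ 1 ∧ h j = 1) : H = ⊤ := by
  classical
  have := Fintype.ofFinite ι
  have key (i : ι) (s : Finset ι) (hs : i ∉ s) (x : G) :
      ∃ h ∈ H, h i = x ∧ ∀ j ∈ s, h j = 1 := by
    induction s using Finset.induction_on generalizing x with
    | empty =>
      obtain ⟨h, hh, rfl⟩ := (surj i).ge (mem_top x)
      exact ⟨h, hh, rfl, by simp⟩
    | insert j s _ ih =>
      simp only [Finset.mem_insert, not_or] at hs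
      let K (t : Set ι) : Subgroup G :=
        (H ⊓ Subgroup.pi t fun _ => ⊥).map (Pi.evalMonoidHom (fun _ => G) i)
      have memK {t : Set ι} {x : G} : x ∈ K t ↔ ∃ h ∈ H, h i = x ∧ ∀ j ∈ t, h j = 1 := by
        simp only [K, mem_map, mem_inf, Subgroup.mem_pi, mem_bot, Pi.evalMonoidHom_apply]
        exact ⟨fun ⟨h, ⟨h₁, h₂⟩, h₃⟩ => ⟨h, h₁, h₃, h₂⟩,
          fun ⟨h, h₁, h₃, h₂⟩ => ⟨h, ⟨h₁, h₂⟩, h₃⟩⟩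
      have hj : K {j} = ⊤ := by
        have hn : (K {j}).Normal := by
          refine ⟨fun x hx g => ?_⟩
          obtain ⟨h, hh, rfl, hhj⟩ := memK.1 hx
          obtain ⟨g', hg', rfl⟩ := (surj i).ge (mem_top g)
          refine memK.2 ⟨g' * h * g'⁻¹, H.mul_mem (H.mul_mem hg' hh) (H.inv_mem hg'), rfl, ?_⟩
          simp_all
        obtain ⟨h, hh, hi, hhj⟩ := sep i j hs.1
        refine hn.eq_bot_or_eq_top.resolve_left fun hbot => hi ?_
        exact (hbot.le (memK.2 ⟨h, hh, rfl, by simpa using hhj⟩) :)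
      suffices hK : ⁅(⊤ : Subgroup G), (⊤ : Subgroup G)⁆ ≤ K (insert j s : Finset ι) by
        simpa using memK.1 (hK (hG.ge (mem_top x)))
      refine commutator_le.2 fun y _ z _ => ?_
      obtain ⟨h, hh, rfl, h₁⟩ := ih hs.2 y
      obtain ⟨h', hh', rfl, h₂⟩ := memK.1 (hj.ge (mem_top z))
      refine memK.2 ⟨⁅h, h'⁆, ?_, rfl, fun l hl => ?_⟩
      · simp only [commutatorElement_def]
        exact H.mul_mem (H.mul_mem (H.mul_mem hh hh') (H.inv_mem hh)) (H.inv_mem hh')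
      · rcases Finset.mem_insert.1 (Finset.mem_coe.1 hl) with rfl | hl
        · simp [commutatorElement_def, h₂ l rfl]
        · simp [commutatorElement_def, h₁ l hl]
  refine (eq_top_iff' H).2 fun x => pi_mem_of_mulSingle_mem x fun i => ?_
  obtain ⟨h, hh, hi, hj⟩ := key i (Finset.univ.erase i) (by simp) (x i)
  convert hh
  ext j
  by_cases hji : j = i
  · subst hji
    simp [hi]
  · rw [Pi.mulSingle_eq_of_ne hji, hj j (by simpa using hji)]

theorem commutator_alternatingGroup_five :
    ⁅(⊤ : Subgroup (alternatingGroup (Fin 5))), (⊤ : Subgroup (alternatingGroup (Fin 5)))⁆ = ⊤ := by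
  refine (IsSimpleGroup.eq_bot_or_eq_top_of_normal _ inferInstance).resolve_left fun h => ?_
  let x : alternatingGroup (Fin 5) := ⟨c[0, 1, 2], Perm.mem_alternatingGroup.2 (by decide)⟩
  let y : alternatingGroup (Fin 5) := ⟨c[2, 3, 4], Perm.mem_alternatingGroup.2 (by decide)⟩
  have hxy : ⁅x, y⁆ = 1 := h.le (commutator_mem_commutator (mem_top x) (mem_top y))
  revert hxy
  decide

/-- A subgroup of `A₅` of order divisible by 30 is everything. -/
theorem alternatingGroup_five_eq_top {H : Subgroup (alternatingGroup (Fin 5))}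
    (h : ∀ p ∈ [2, 3, 5], ∃ x ∈ H, orderOf x = p) : H = ⊤ := by
  have hdvd (p : ℕ) (hp : p ∈ [2, 3, 5]) : p ∣ Nat.card H := by
    obtain ⟨x, hx, rfl⟩ := h p hp
    exact H.orderOf_dvd_natCard hx
  have h2 := hdvd 2 (by simp)
  have h3 := hdvd 3 (by simp)
  have h5 := hdvd 5 (by simp)
  have hcard : Nat.card (alternatingGroup (Fin 5)) = 60 := by
    rw [nat_card_alternatingGroup]
    simp [Nat.factorial]
  have hmul := H.card_mul_index
  rw [hcard] at hmul
  obtain ⟨m, hm⟩ : 30 ∣ Nat.card H := by omega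
  have hi : H.index = 1 ∨ H.index = 2 := by
    have hmi : m * H.index = 2 := by
      rw [hm] at hmul
      lia
    exact (Nat.dvd_prime Nat.prime_two).1 ⟨m, by rw [mul_comm, hmi]⟩
  refine hi.elim index_eq_one.1 fun hi => ?_
  refine ((normal_of_index_eq_two hi).eq_bot_or_eq_top).resolve_left ?_
  rintro rfl
  simp at h2

/-- Representatives of the orbits of `Aut A₅` on generating pairs of `A₅`. -/
def genPair : Fin 19 → Perm (Fin 5) × Perm (Fin 5) := ![
  (c[0, 1, 2, 3, 4], c[0, 1, 4, 3, 2]),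
  (c[0, 1, 2, 3, 4], c[0, 2, 4, 3, 1]),
  (c[1, 2] * c[3, 4], c[0, 1, 3, 2, 4]),
  (c[0, 1, 2, 3, 4], c[2, 4, 3]),
  (c[2, 3, 4], c[0, 1, 2, 3, 4]),
  (c[2, 3, 4], c[0, 2, 1, 3, 4]),
  (c[1, 2] * c[3, 4], c[0, 1, 2, 3, 4]),
  (c[0, 1, 2, 3, 4], c[0, 1, 3, 4, 2]),
  (c[2, 3, 4], c[0, 2, 4, 1, 3]),
  (c[0, 1, 2, 3, 4], c[1, 3] * c[2, 4]),
  (c[0, 1, 2, 3, 4], c[1, 2] * c[3, 4]),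
  (c[0, 1, 2, 3, 4], c[1, 4, 2]),
  (c[0, 1, 2, 3, 4], c[2, 3, 4]),
  (c[0, 1, 2, 3, 4], c[1, 2, 4]),
  (c[2, 3, 4], c[0, 1, 2, 4, 3]),
  (c[1, 2] * c[3, 4], c[0, 1, 3]),
  (c[2, 3, 4], c[0, 2] * c[1, 3]),
  (c[2, 3, 4], c[0, 1, 2]),
  (c[0, 1, 2, 3, 4], c[0, 1, 2, 4, 3])]

theorem genPair_mem (i : Fin 19) :
    (genPair i).1 ∈ alternatingGroup (Fin 5) ∧ (genPair i).2 ∈ alternatingGroup (Fin 5) := by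
  simp only [Perm.mem_alternatingGroup]
  revert i
  decide +kernel

def genA (i : Fin 19) : alternatingGroup (Fin 5) := ⟨(genPair i).1, (genPair_mem i).1⟩

def genB (i : Fin 19) : alternatingGroup (Fin 5) := ⟨(genPair i).2, (genPair_mem i).2⟩

/-- The words `a`, `b`, `ab`, `a²b`, `ab²`, `a²b²`, `a²bab`. -/
def testWord : Fin 7 → List Bool :=
  ![[true], [false], [true, false], [true, true, false], [true, false, false],
    [true, true, false, false], [true, true, false, true, false]]

/-- The order of each test word at each pair of generators. -/
def wordOrder : Fin 19 → Fin 7 → ℕ := ![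
  ![5, 5, 3, 3, 3, 2, 5],
  ![5, 5, 3, 2, 2, 5, 5],
  ![2, 5, 5, 5, 3, 5, 3],
  ![5, 3, 3, 5, 5, 2, 3],
  ![3, 5, 5, 3, 2, 5, 5],
  ![3, 5, 5, 2, 5, 3, 3],
  ![2, 5, 3, 5, 5, 5, 5],
  ![5, 5, 5, 3, 3, 3, 2],
  ![3, 5, 2, 5, 3, 5, 3],
  ![5, 2, 5, 3, 5, 5, 3],
  ![5, 2, 3, 5, 5, 5, 2],
  ![5, 3, 2, 3, 5, 5, 5],
  ![5, 3, 5, 2, 3, 5, 5],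
  ![5, 3, 5, 5, 2, 3, 3],
  ![3, 5, 3, 5, 5, 2, 5],
  ![2, 3, 5, 3, 5, 3, 5],
  ![3, 2, 5, 5, 3, 3, 5],
  ![3, 3, 5, 5, 5, 5, 2],
  ![5, 5, 2, 5, 5, 3, 5]]

theorem wordOrder_mem (i : Fin 19) (w : Fin 7) : wordOrder i w ∈ [2, 3, 5] := by
  revert i w
  decide

theorem wordOrder_prime (i : Fin 19) (w : Fin 7) : (wordOrder i w).Prime := by
  have h := wordOrder_mem i w
  simp only [List.mem_cons, List.not_mem_nil, or_false] at h
  rcases h with h | h | h <;> rw [h] <;> norm_num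

theorem orderOf_evalWord (i : Fin 19) (w : Fin 7) :
    orderOf (evalWord (genA i) (genB i) (testWord w)) = wordOrder i w := by
  have := Fact.mk (wordOrder_prime i w)
  have h : evalWord (genPair i).1 (genPair i).2 (testWord w) ^ wordOrder i w = 1 ∧
      evalWord (genPair i).1 (genPair i).2 (testWord w) ≠ 1 := by
    clear this
    revert i w
    decide +kernel
  rw [← Subgroup.orderOf_coe, ← Subgroup.subtype_apply, map_evalWord]
  exact orderOf_eq_prime h.1 h.2

theorem closure_gen_eq_top {k : ℕ} {s : Fin k → Fin 19} (hs : s.Injective) :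
    closure {genA ∘ s, genB ∘ s, (genA ∘ s * genB ∘ s)⁻¹} = ⊤ := by
  set H := closure {genA ∘ s, genB ∘ s, (genA ∘ s * genB ∘ s)⁻¹}
  have hmem (w : Fin 7) : evalWord (genA ∘ s) (genB ∘ s) (testWord w) ∈ H :=
    evalWord_mem (subset_closure (by simp)) (subset_closure (by simp)) _
  have happ (i : Fin k) (w : Fin 7) : evalWord (genA ∘ s) (genB ∘ s) (testWord w) i =
      evalWord (genA (s i)) (genB (s i)) (testWord w) :=
    map_evalWord (Pi.evalMonoidHom (fun _ => alternatingGroup (Fin 5)) i) _ _ _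
  refine H.eq_top_of_separates commutator_alternatingGroup_five (fun i => ?_) fun i j hij => ?_
  · refine alternatingGroup_five_eq_top fun p hp => ?_
    obtain ⟨w, rfl⟩ : ∃ w, wordOrder (s i) w = p := by
      generalize s i = i'
      revert p i'
      decide
    exact ⟨_, mem_map_of_mem _ (hmem w), by simp [happ, orderOf_evalWord]⟩
  · obtain ⟨w, hw⟩ : ∃ w, wordOrder (s i) w ≠ wordOrder (s j) w := by
      have := hs.ne hij
      revert this
      generalize s i = i'
      generalize s j = j'
      revert i' j'
      decide
    refine ⟨_, H.pow_mem (hmem w) (wordOrder (s j) w), ?_, ?_⟩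
    · rw [Pi.pow_apply, happ, Ne, ← orderOf_dvd_iff_pow_eq_one, orderOf_evalWord]
      exact fun h => hw ((Nat.prime_dvd_prime_iff_eq (wordOrder_prime _ _)
        (wordOrder_prime _ _)).1 h)
    · rw [Pi.pow_apply, happ, ← orderOf_dvd_iff_pow_eq_one, orderOf_evalWord]

/-- The orders in the triple `(a, b, (ab)⁻¹)` attached to a pair of generators. -/
theorem orderOf_triple (i : Fin 19) :
    orderOf (genA i) = wordOrder i 0 ∧ orderOf (genB i) = wordOrder i 1 ∧
      orderOf (genA i * genB i)⁻¹ = wordOrder i 2 := by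
  refine ⟨?_, ?_, ?_⟩
  · simpa [testWord, evalWord] using orderOf_evalWord i 0
  · simpa [testWord, evalWord] using orderOf_evalWord i 1
  · rw [orderOf_inv]
    simpa [testWord, evalWord] using orderOf_evalWord i 2

/-- If the orders of the components of `d` and `d'` are prime and no order occurs in the same
positions in `d` as in `d'`, then only `1` is conjugate both to a power of `d` and to one of `d'`. -/
theorem eq_one_of_isConj_zpow {ι G : Type*} [Group G] {d d' g : ι → G}
    (hd : ∀ i, (orderOf (d i)).Prime) (hd' : ∀ i, (orderOf (d' i)).Prime)
    (hne : ∀ i, ∃ j, ¬(orderOf (d j) = orderOf (d i) ↔ orderOf (d' j) = orderOf (d i)))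
    {m n : ℤ} (hm : IsConj (d ^ m) g) (hn : IsConj (d' ^ n) g) : g = 1 := by
  have order_eq {x y : G} {m : ℤ} (hx : (orderOf x).Prime) (h : IsConj (x ^ m) y) :
      (y = 1 ↔ (orderOf x : ℤ) ∣ m) ∧ (y ≠ 1 → orderOf y = orderOf x) := by
    have ho : orderOf (x ^ m) = orderOf y := by
      obtain ⟨c, rfl⟩ := isConj_iff.1 h
      exact (orderOf_injective (MulAut.conj c).toMonoidHom (MulAut.conj c).injective _).symm
    have h1 : y = 1 ↔ (orderOf x : ℤ) ∣ m := by
      rw [orderOf_dvd_iff_zpow_eq_one, ← orderOf_eq_one_iff, ← ho, orderOf_eq_one_iff]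
    refine ⟨h1, fun hy => ?_⟩
    refine ((Nat.dvd_prime hx).1 (ho ▸ orderOf_dvd_of_mem_zpowers ⟨m, rfl⟩)).resolve_left ?_
    rwa [orderOf_eq_one_iff]
  have key (i : ι) := order_eq (hd i) (MonoidHom.map_isConj (Pi.evalMonoidHom (fun _ => G) i) hm)
  have key' (i : ι) := order_eq (hd' i) (MonoidHom.map_isConj (Pi.evalMonoidHom (fun _ => G) i) hn)
  simp only [Pi.evalMonoidHom_apply] at key key'
  ext i
  by_contra hi
  have ho := (key i).2 hi
  have ho' := (key' i).2 hi
  obtain ⟨j, hj⟩ := hne i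
  refine hj ⟨fun h => ?_, fun h => ?_⟩
  · have hgj : g j ≠ 1 := by rwa [Ne, (key j).1, h, ← (key i).1]
    rw [← (key' j).2 hgj, (key j).2 hgj, h]
  · have hgj : g j ≠ 1 := by rwa [Ne, (key' j).1, h, ← ho, ho', ← (key' i).1]
    rw [← (key j).2 hgj, (key' j).2 hgj, h]

theorem one_div_orderOf_add_lt {G ι : Type*} [Group G] [Finite G] [Finite ι] (i : ι)
    (a b c : ι → G)
    (h : (1 : ℚ) / orderOf (a i) + 1 / orderOf (b i) + 1 / orderOf (c i) < 1) :
    (1 : ℚ) / orderOf a + 1 / orderOf b + 1 / orderOf c < 1 := by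
  have hle (x : ι → G) : (1 : ℚ) / orderOf x ≤ 1 / orderOf (x i) := by
    refine one_div_le_one_div_of_le (mod_cast orderOf_pos (x i)) ?_
    exact mod_cast Nat.le_of_dvd (orderOf_pos x) (orderOf_map_dvd (Pi.evalMonoidHom _ i) x)
  linarith [hle a, hle b, hle c]

/-- The order in which the second triple runs through the generating pairs. -/
def reorder : Fin 19 → Fin 19 := ![17, 1, 4, 14, 16, 18, 5, 13, 3, 11, 10, 0, 6, 15, 8, 7, 12, 9, 2]

/-- No order occurs at the same positions in the first `k` entries of a member of the first triple
and of one of the second. -/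
theorem wordOrder_reorder : ∀ k : Fin 20, 2 ≤ k.val → ∀ (t t' : Fin 3) (i : Fin 19), i.val < k.val →
    ∃ j : Fin 19, j.val < k.val ∧
      ¬(wordOrder j (t.castLE (by simp)) = wordOrder i (t.castLE (by simp)) ↔
        wordOrder (reorder j) (t'.castLE (by simp)) = wordOrder i (t.castLE (by simp))) := by
  decide +kernel

theorem A5_power_beauville (k : ℕ) (hk1 : 2 ≤ k) (hk2 : k ≤ 19) :
    IsBeauvilleGroup (Fin k → alternatingGroup (Fin 5)) := by
  let s : Fin k → Fin 19 := Fin.castLE hk2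
  have hs : s.Injective := Fin.castLE_injective hk2
  have hrs : (reorder ∘ s).Injective := by
    have : reorder.Injective := by decide
    exact this.comp hs
  have hyp (s : Fin k → Fin 19)
      (h : (1 : ℚ) / wordOrder (s ⟨0, by omega⟩) 0 + 1 / wordOrder (s ⟨0, by omega⟩) 1 +
        1 / wordOrder (s ⟨0, by omega⟩) 2 < 1) :
      (1 : ℚ) / orderOf (genA ∘ s) + 1 / orderOf (genB ∘ s) +
        1 / orderOf (genA ∘ s * genB ∘ s)⁻¹ < 1 := by
    obtain ⟨ha, hb, hc⟩ := orderOf_triple (s ⟨0, by omega⟩)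
    refine one_div_orderOf_add_lt ⟨0, by omega⟩ _ _ _ ?_
    simpa only [Function.comp_apply, Pi.inv_apply, Pi.mul_apply, ha, hb, hc] using h
  have order_eq (s : Fin k → Fin 19) (d : Fin k → alternatingGroup (Fin 5))
      (hd : d ∈ ({genA ∘ s, genB ∘ s, (genA ∘ s * genB ∘ s)⁻¹} : Set _)) :
      ∃ t : Fin 3, ∀ i, orderOf (d i) = wordOrder (s i) (t.castLE (by simp)) := by
    rcases hd with rfl | rfl | rfl
    · exact ⟨0, fun i => (orderOf_triple (s i)).1⟩
    · exact ⟨1, fun i => (orderOf_triple (s i)).2.1⟩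
    · exact ⟨2, fun i => (orderOf_triple (s i)).2.2⟩
  refine ⟨_, _, _, _, _, _, ⟨closure_gen_eq_top hs, mul_inv_cancel _, hyp s ?_⟩,
    ⟨closure_gen_eq_top hrs, mul_inv_cancel _, hyp (reorder ∘ s) ?_⟩, ?_⟩
  · change (1 : ℚ) / (5 : ℕ) + 1 / (5 : ℕ) + 1 / (3 : ℕ) < 1
    norm_num
  · change (1 : ℚ) / (3 : ℕ) + 1 / (3 : ℕ) + 1 / (5 : ℕ) < 1
    norm_num
  refine Set.eq_singleton_iff_unique_mem.2 ⟨⟨⟨_, Or.inl rfl, 0, ?_⟩, ⟨_, Or.inl rfl, 0, ?_⟩⟩, ?_⟩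
  · exact zpow_zero (_ : Fin k → alternatingGroup (Fin 5)) ▸ IsConj.refl _
  · exact zpow_zero (_ : Fin k → alternatingGroup (Fin 5)) ▸ IsConj.refl _
  rintro g ⟨⟨d, hd, m, hm⟩, ⟨d', hd', n, hn⟩⟩
  obtain ⟨t, ht⟩ := order_eq _ d hd
  obtain ⟨t', ht'⟩ := order_eq _ d' hd'
  refine eq_one_of_isConj_zpow (fun i => ?_) (fun i => ?_) (fun i => ?_) hm hn
  · exact ht i ▸ wordOrder_prime _ _
  · exact ht' i ▸ wordOrder_prime _ _
  · obtain ⟨j, hjk, hj⟩ := wordOrder_reorder ⟨k, by omega⟩ hk1 t t' (s i) i.2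
    exact ⟨⟨j, hjk⟩, by rwa [ht, ht, ht']⟩
end
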